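/- Let k ≥ 2 be an integer. Every 2-connected finite simple graph G of minimum degree at least k that contains a triangle K_3 as a subgraph contains k cycles of consecutive lengths, unless G is isomorphic to the complete graph K_{k+1}. -/

import Mathlib

/-- `G` contains a cycle of length `n`. -/
def HasCycleLength {V : Type*} (G : SimpleGraph V) (n : ℕ) : Prop :=
  ∃ (u : V) (c : G.Walk u u), c.IsCycle ∧ c.length = n

/-- A finite graph is 2-connected: it has at least 3 vertices and remains connected after
deleting any single vertex. -/
def TwoConnected {V : Type*} [Fintype V] (G : SimpleGraph V) : Prop :=
  3 ≤ Fintype.card V ∧ ∀ v : V, (G.induce ({v}ᶜ : Set V)).Connected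

namespace EarCycles

open scoped Classical

/-- `S` contains `n` integers in increasing order whose successive gaps are at most two. -/
def Chain (n : ℕ) (S : Set ℕ) : Prop :=
  ∃ f : ℕ → ℕ, (∀ i < n, f i ∈ S) ∧ ∀ i, i + 1 < n → f i < f (i + 1) ∧ f (i + 1) ≤ f i + 2

theorem Chain.mono {n m : ℕ} {S T : Set ℕ} (h : Chain n S) (hm : m ≤ n) (hST : S ⊆ T) :
    Chain m T := by
  obtain ⟨f, h1, h2⟩ := h
  exact ⟨f, fun i hi => hST (h1 i (by omega)), fun i hi => h2 i (by omega)⟩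

theorem chain_one {S : Set ℕ} {s : ℕ} (h : s ∈ S) : Chain 1 S :=
  ⟨fun _ => s, fun _ _ => h, fun i hi => by omega⟩

theorem chain_two {S : Set ℕ} {s t : ℕ} (h : s ∈ S) (h' : t ∈ S) (h1 : s < t) (h2 : t ≤ s + 2) :
    Chain 2 S := by
  refine ⟨fun i => if i = 0 then s else t, fun i hi => ?_, fun i hi => ?_⟩
  · show (if i = 0 then s else t) ∈ S
    split_ifs <;> assumption
  · obtain rfl : i = 0 := by omega
    simp [h1, h2]

theorem chain_three {S : Set ℕ} {s t u : ℕ} (h : s ∈ S) (h' : t ∈ S) (h'' : u ∈ S) (h1 : s < t)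
    (h2 : t ≤ s + 2) (h3 : t < u) (h4 : u ≤ t + 2) : Chain 3 S := by
  refine ⟨fun i => if i = 0 then s else if i = 1 then t else u, fun i hi => ?_, fun i hi => ?_⟩
  · show (if i = 0 then s else if i = 1 then t else u) ∈ S
    split_ifs <;> assumption
  · have : i = 0 ∨ i = 1 := by omega
    rcases this with rfl | rfl <;> simp [h1, h2, h3, h4]

theorem chain_arith (n a d : ℕ) (hd : 1 ≤ d) (hd2 : d ≤ 2) {S : Set ℕ}
    (h : ∀ i < n, a + d * i ∈ S) : Chain n S :=
  ⟨fun i => a + d * i, h, fun i _ => by constructor <;> simp only [mul_add] <;> omega⟩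

/-- Offsets `O h` available at the places `h` of `X`; any chain of lengths, each started at some
place, is prolonged by `p - 1` when the offsets are added. -/
def Pattern {α : Type*} (X : Finset α) (O : α → Set ℕ) (p : ℕ) : Prop :=
  ∀ n, 1 ≤ n → ∀ L : α → Set ℕ, Chain n {l | ∃ h ∈ X, l ∈ L h} →
    Chain (n + p - 1) {m | ∃ h ∈ X, ∃ l ∈ L h, ∃ o ∈ O h, m = l + o}

theorem pattern_of {α : Type*} {X : Finset α} {O : α → Set ℕ} {p : ℕ} (hp : 1 ≤ p) (M : ℕ)
    (h : ∀ x ∈ X, ∃ g : ℕ → ℕ, (∀ i < p, g i ∈ O x) ∧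
      (∀ i, i + 1 < p → g i < g (i + 1) ∧ g (i + 1) ≤ g i + 2) ∧ g (p - 1) = M) :
    Pattern X O p := by
  intro n hn L hc
  obtain ⟨f, h1, h2⟩ := hc
  obtain ⟨x, hx, hxl⟩ := h1 0 (by omega)
  obtain ⟨g, hg1, hg2, hg3⟩ := h x hx
  refine ⟨fun i => if i < p then f 0 + g i else f (i - (p - 1)) + M, fun i hi => ?_, fun i hi => ?_⟩
  · show (if i < p then f 0 + g i else f (i - (p - 1)) + M) ∈ _
    split_ifs with hip
    · exact ⟨x, hx, f 0, hxl, g i, hg1 i hip, rfl⟩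
    · obtain ⟨y, hy, hyl⟩ := h1 (i - (p - 1)) (by omega)
      obtain ⟨g', hg1', hg2', hg3'⟩ := h y hy
      exact ⟨y, hy, _, hyl, M, hg3' ▸ hg1' (p - 1) (by omega), rfl⟩
  · by_cases c1 : i + 1 < p
    · have := hg2 i c1
      simp only [c1, if_true, show i < p by omega]
      omega
    · by_cases c2 : i < p
      · obtain rfl : i = p - 1 := by omega
        have := h2 0 (by omega)
        simp only [c1, if_false, c2, if_true]
        have e : p - 1 + 1 - (p - 1) = 0 + 1 := by omega
        rw [e]
        omega
      · have := h2 (i - (p - 1)) (by omega)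
        simp only [c1, if_false, c2]
        have e : i + 1 - (p - 1) = i - (p - 1) + 1 := by omega
        rw [e]
        omega

theorem pattern_arith {α : Type*} {X : Finset α} {O : α → Set ℕ} {p : ℕ} (hp : 1 ≤ p) (a d : ℕ)
    (hd : 1 ≤ d) (hd2 : d ≤ 2) (h : ∀ x ∈ X, ∀ i < p, a + d * i ∈ O x) :
    Pattern X O p :=
  pattern_of hp (a + d * (p - 1)) fun x hx => ⟨fun i => a + d * i, h x hx, fun i _ => by
    constructor <;> simp only [mul_add] <;> omega, rfl⟩

theorem Chain.add {n m : ℕ} (hn : 1 ≤ n) (hm : 1 ≤ m) {S O T : Set ℕ} (h : Chain n S)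
    (h' : Chain m O) (hT : ∀ s ∈ S, ∀ o ∈ O, s + o ∈ T) : Chain (n + m - 1) T := by
  obtain ⟨g, hg1, hg2⟩ := h'
  have := pattern_of (X := ({()} : Finset Unit)) (O := fun _ => O) hm (g (m - 1))
    (fun x _ => ⟨g, hg1, hg2, rfl⟩) n hn (fun _ => S) (by simpa using h)
  refine this.mono le_rfl ?_
  rintro _ ⟨_, _, l, hl, o, ho, rfl⟩
  exact hT l hl o ho

theorem Chain.shift {n : ℕ} {S T : Set ℕ} (c : ℕ) (h : Chain n S) (hT : ∀ s ∈ S, s + c ∈ T) :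
    Chain n T := by
  obtain ⟨f, h1, h2⟩ := h
  exact ⟨fun i => f i + c, fun i hi => hT _ (h1 i hi), fun i hi => by
    have := h2 i hi
    constructor <;> dsimp only <;> omega⟩

/-- Sums of a chain with an interval of length at least two fill an interval. -/
theorem Chain.fill {n m : ℕ} (hm : 2 ≤ m) {S : Set ℕ} :
    1 ≤ n → Chain n S → ∃ s₀, ∀ i < n + m - 1, ∃ s ∈ S, ∃ o < m, s₀ + i = s + o := by
  rintro hn ⟨f, h1, h2⟩
  refine ⟨f 0, ?_⟩
  induction n, hn using Nat.le_induction with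
  | base => exact fun i hi => ⟨f 0, h1 0 (by omega), i, by omega, rfl⟩
  | succ n hn ih =>
    intro i hi
    have mon : ∀ j, j ≤ n → f 0 + j ≤ f j := by
      intro j
      induction j with
      | zero => intro _; omega
      | succ j ihj => intro hj; have := h2 j (by omega); have := ihj (by omega); omega
    by_cases c : f 0 + i < f n
    · have key : ∀ j, j ≤ n → f 0 + i < f j → ∃ s ∈ S, ∃ o < m, f 0 + i = s + o := by
        intro j
        induction j with
        | zero => intro _ h; omega
        | succ j ihj =>
          intro hj h
          by_cases c' : f 0 + i < f j
          · exact ihj (by omega) c'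
          · have := h2 j (by omega)
            exact ⟨f j, h1 j (by omega), f 0 + i - f j, by omega, by omega⟩
      exact key n le_rfl c
    · have := mon n le_rfl
      exact ⟨f n, h1 n (by omega), f 0 + i - f n, by omega, by omega⟩

variable {V : Type*} {G : SimpleGraph V}

/-- There is a path of length `n` from `u` to `v` all of whose vertices lie in `A`. -/
def PL (G : SimpleGraph V) : ℕ → Finset V → V → V → Prop
  | 0, A, u, v => u ∈ A ∧ u = v
  | n + 1, A, u, v => u ∈ A ∧ ∃ x, G.Adj u x ∧ PL G n (A.erase u) x v

theorem PL.left {n : ℕ} {A : Finset V} {u v : V} (h : PL G n A u v) : u ∈ A := by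
  cases n <;> exact h.1

theorem PL.mono {n : ℕ} {A B : Finset V} {u v : V} (h : PL G n A u v) (hAB : A ⊆ B) :
    PL G n B u v := by
  induction n generalizing A B u with
  | zero => exact ⟨hAB h.1, h.2⟩
  | succ n ih =>
    obtain ⟨hu, x, hx, hp⟩ := h
    exact ⟨hAB hu, x, hx, ih hp (Finset.erase_subset_erase _ hAB)⟩

theorem PL.refl {A : Finset V} {u : V} (h : u ∈ A) : PL G 0 A u u := ⟨h, rfl⟩

theorem PL.right {n : ℕ} {A : Finset V} {u v : V} (h : PL G n A u v) : v ∈ A := by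
  induction n generalizing A u with
  | zero => exact h.2 ▸ h.1
  | succ n ih =>
    obtain ⟨hu, x, hx, hp⟩ := h
    exact Finset.mem_of_mem_erase (ih hp)

theorem PL.glue {n m : ℕ} {A B : Finset V} {u v x y : V} (h : PL G n A u v) (h' : PL G m B x y)
    (hd : Disjoint A B) (ha : G.Adj v x) : PL G (n + 1 + m) (A ∪ B) u y := by
  induction n generalizing A u with
  | zero =>
    obtain ⟨hu, rfl⟩ := h
    rw [Nat.zero_add, Nat.add_comm]
    refine ⟨Finset.mem_union_left _ hu, x, ha, h'.mono ?_⟩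
    intro b hb
    exact Finset.mem_erase.2 ⟨fun e => Finset.disjoint_left.1 hd hu (e ▸ hb),
      Finset.mem_union_right _ hb⟩
  | succ n ih =>
    obtain ⟨hu, z, hz, hp⟩ := h
    have := ih hp (hd.mono_left (Finset.erase_subset _ _))
    rw [show n + 1 + 1 + m = (n + 1 + m) + 1 by omega]
    refine ⟨Finset.mem_union_left _ hu, z, hz, this.mono ?_⟩
    intro b hb
    rw [Finset.mem_union, Finset.mem_erase] at hb
    rw [Finset.mem_erase, Finset.mem_union]
    rcases hb with hb | hb
    · exact ⟨hb.1, Or.inl hb.2⟩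
    · exact ⟨fun e => Finset.disjoint_left.1 hd hu (e ▸ hb), Or.inr hb⟩

theorem PL.symm {n : ℕ} {A : Finset V} {u v : V} (h : PL G n A u v) : PL G n A v u := by
  induction n generalizing A u with
  | zero => obtain ⟨hu, rfl⟩ := h; exact ⟨hu, rfl⟩
  | succ n ih =>
    obtain ⟨hu, x, hx, hp⟩ := h
    have := (ih hp).glue (PL.refl (G := G) (Finset.mem_singleton_self u)) (by simp) hx.symm
    refine this.mono ?_
    intro b hb
    simp only [Finset.mem_union, Finset.mem_erase, Finset.mem_singleton] at hb
    rcases hb with hb | rfl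
    · exact hb.2
    · exact hu

theorem PL.append {n m : ℕ} {A B : Finset V} {u v w : V} (h : PL G n A u v) (h' : PL G m B v w)
    (hd : ∀ x ∈ A, x ∈ B → x = v) : PL G (n + m) (A ∪ B) u w := by
  cases m with
  | zero => obtain ⟨_, rfl⟩ := h'; exact h.mono Finset.subset_union_left
  | succ m =>
    obtain ⟨hu, x, hx, hp⟩ := h'
    have := h.glue hp (Finset.disjoint_left.2 fun a ha hb => by
      rw [Finset.mem_erase] at hb
      exact hb.1 (hd a ha hb.2)) hx
    rw [show n + (m + 1) = n + 1 + m by omega]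
    exact this.mono (Finset.union_subset_union_right (Finset.erase_subset _ _))

theorem PL.cons {n : ℕ} {A : Finset V} {u v w : V} (h : PL G n A u v) (hw : w ∉ A)
    (ha : G.Adj w u) : PL G (n + 1) (insert w A) w v :=
  ⟨Finset.mem_insert_self _ _, u, ha, by rwa [Finset.erase_insert hw]⟩

theorem PL.edge {A : Finset V} {u v : V} (hu : u ∈ A) (hv : v ∈ A) (ha : G.Adj u v) :
    PL G 1 A u v :=
  ⟨hu, v, ha, Finset.mem_erase.2 ⟨ha.ne', hv⟩, rfl⟩

theorem PL.extend {n : ℕ} {A : Finset V} {u a b : V} (h : PL G n A u a) (hb : b ∈ A)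
    (ha : G.Adj a b) : ∃ m, PL G m A u b := by
  induction n generalizing A u with
  | zero => obtain ⟨hu, rfl⟩ := h; exact ⟨1, PL.edge hu hb ha⟩
  | succ n ih =>
    obtain ⟨hu, x, hx, hp⟩ := h
    by_cases c : b = u
    · subst c; exact ⟨0, hu, rfl⟩
    · obtain ⟨m, hm⟩ := ih hp (Finset.mem_erase.2 ⟨c, hb⟩)
      exact ⟨m + 1, hu, x, hx, hm⟩

theorem PL.toWalk {n : ℕ} {A : Finset V} {u v : V} (h : PL G n A u v) :
    ∃ p : G.Walk u v, p.IsPath ∧ (∀ x ∈ p.support, x ∈ A) ∧ p.length = n := by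
  induction n generalizing A u with
  | zero => obtain ⟨hu, rfl⟩ := h; exact ⟨.nil, by simp, by simpa using hu, rfl⟩
  | succ n ih =>
    obtain ⟨hu, x, hx, hp⟩ := h
    obtain ⟨p, h1, h2, h3⟩ := ih hp
    refine ⟨.cons hx p, ?_, ?_, by simp [h3]⟩
    · rw [SimpleGraph.Walk.cons_isPath_iff]
      exact ⟨h1, fun hm => by simpa using h2 _ hm⟩
    · intro y hy
      rw [SimpleGraph.Walk.support_cons, List.mem_cons] at hy
      rcases hy with rfl | hy
      · exact hu
      · exact Finset.mem_of_mem_erase (h2 y hy)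

/-- The lengths of paths inside `A` from a vertex of `R` to `w`. -/
def LS (G : SimpleGraph V) (A : Finset V) (R : V → Prop) (w : V) : Set ℕ :=
  {n | ∃ r, R r ∧ PL G n A r w}

theorem LS.mono {A B : Finset V} {R : V → Prop} {w : V} (h : A ⊆ B) : LS G A R w ⊆ LS G B R w :=
  fun _ ⟨r, hr, hp⟩ => ⟨r, hr, hp.mono h⟩

/-- The number of neighbours of `w` in `A`. -/
noncomputable def dg (G : SimpleGraph V) (A : Finset V) (w : V) : ℕ :=
  (A.filter fun x => G.Adj w x).card

theorem dg_union {A B : Finset V} (h : Disjoint A B) (w : V) :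
    dg G (A ∪ B) w = dg G A w + dg G B w := by
  rw [dg, Finset.filter_union, Finset.card_union_of_disjoint (h.mono (Finset.filter_subset _ _)
    (Finset.filter_subset _ _))]
  rfl

theorem dg_mono {A B : Finset V} (h : A ⊆ B) (w : V) : dg G A w ≤ dg G B w :=
  Finset.card_le_card (Finset.filter_subset_filter _ h)

theorem dg_pos {A : Finset V} {w : V} : 1 ≤ dg G A w ↔ ∃ x ∈ A, G.Adj w x := by
  rw [dg, Nat.one_le_iff_ne_zero, ← Nat.pos_iff_ne_zero, Finset.card_pos, Finset.filter_nonempty_iff]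

theorem dg_zero {A : Finset V} {w : V} : dg G A w = 0 ↔ ∀ x ∈ A, ¬ G.Adj w x := by
  rw [dg, Finset.card_eq_zero, Finset.filter_eq_empty_iff]

theorem dg_le {A B : Finset V} {w : V} (h : ∀ x ∈ A, G.Adj w x → x ∈ B) : dg G A w ≤ B.card :=
  Finset.card_le_card fun x hx => by
    rw [Finset.mem_filter] at hx
    exact h x hx.1 hx.2

theorem dg_congr {A B : Finset V} {w : V} (h : ∀ x, G.Adj w x → (x ∈ A ↔ x ∈ B)) :
    dg G A w = dg G B w := by
  unfold dg
  congr 1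
  ext x
  simp only [Finset.mem_filter]
  constructor
  · exact fun ⟨a, b⟩ => ⟨(h x b).1 a, b⟩
  · exact fun ⟨a, b⟩ => ⟨(h x b).2 a, b⟩

theorem dg_le_of {A B : Finset V} {w : V} (h : ∀ x ∈ A, G.Adj w x → x ∈ B) :
    dg G A w ≤ dg G B w :=
  Finset.card_le_card fun x hx => by
    rw [Finset.mem_filter] at hx ⊢
    exact ⟨h x hx.1 hx.2, hx.2⟩

theorem dg_singleton_le {w x : V} : dg G {x} w ≤ 1 :=
  (Finset.card_filter_le _ _).trans (by simp)

theorem dg_eq_sdiff {A H : Finset V} (h : H ⊆ A) (w : V) :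
    dg G A w = dg G (A \ H) w + dg G H w := by
  rw [← dg_union (Finset.sdiff_disjoint), Finset.sdiff_union_of_subset h]

/-- The subgraph induced on `A` is connected. -/
def Conn (G : SimpleGraph V) (A : Finset V) : Prop :=
  A.Nonempty ∧ ∀ C ⊆ A, C.Nonempty → C ≠ A → ∃ a ∈ C, ∃ b ∈ A \ C, G.Adj a b

theorem Conn.path {A : Finset V} (h : Conn G A) {u v : V} (hu : u ∈ A) (hv : v ∈ A) :
    ∃ n, PL G n A u v := by
  by_contra hc
  obtain ⟨a, ha, b, hb, hab⟩ := h.2 (A.filter fun x => ∃ n, PL G n A u x) (Finset.filter_subset _ _)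
    ⟨u, by simp only [Finset.mem_filter]; exact ⟨hu, 0, PL.refl hu⟩⟩
    (fun e => by
      rw [← e, Finset.mem_filter] at hv
      exact hc hv.2)
  simp only [Finset.mem_filter, Finset.mem_sdiff] at ha hb
  obtain ⟨-, n, hn⟩ := ha
  exact hb.2 ⟨hb.1, hn.extend hb.1 hab⟩

/-- `C` is (the vertex set of) a component of the graph induced on `A`. -/
def Comp (G : SimpleGraph V) (A C : Finset V) : Prop :=
  C ⊆ A ∧ Conn G C ∧ ∀ a ∈ C, ∀ b ∈ A, G.Adj a b → b ∈ C

theorem exists_comp {A : Finset V} {v : V} (hv : v ∈ A) : ∃ C, v ∈ C ∧ Comp G A C := by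
  let P : Finset V → Prop := fun C => C ⊆ A ∧ v ∈ C ∧ ∀ a ∈ C, ∀ b ∈ A, G.Adj a b → b ∈ C
  have hP : P A := ⟨subset_rfl, hv, fun _ _ b hb _ => hb⟩
  obtain ⟨C, hC, hmin⟩ := exists_minimal_le_of_wellFoundedLT P A hP
  obtain ⟨h1, h2, h3⟩ := hmin.prop
  refine ⟨C, h2, h1, ⟨⟨v, h2⟩, fun E hE hEn hne => ?_⟩, h3⟩
  by_contra hcon
  push Not at hcon
  by_cases hvE : v ∈ E
  · have : P E := ⟨hE.trans h1, hvE, fun a ha b hb hab => by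
      by_contra hbE
      exact hcon a ha b (Finset.mem_sdiff.2 ⟨h3 a (hE ha) b hb hab, hbE⟩) hab⟩
    exact hne (subset_antisymm hE (hmin.2 this hE))
  · have : P (C \ E) := ⟨(Finset.sdiff_subset).trans h1, Finset.mem_sdiff.2 ⟨h2, hvE⟩,
      fun a ha b hb hab => by
        rw [Finset.mem_sdiff] at ha ⊢
        refine ⟨h3 a ha.1 b hb hab, fun hbE => ?_⟩
        exact hcon b hbE a (Finset.mem_sdiff.2 ha) hab.symm⟩
    obtain ⟨e, he⟩ := hEn
    exact (Finset.mem_sdiff.1 (hmin.2 this Finset.sdiff_subset (hE he))).2 he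

/-- `u` separates the nonempty set `C` from the rest of `A`. -/
def Hang (G : SimpleGraph V) (A C : Finset V) (u : V) : Prop :=
  C ⊆ A ∧ C.Nonempty ∧ u ∈ A ∧ u ∉ C ∧ ∀ c ∈ C, ∀ b ∈ A, G.Adj c b → b ∈ C ∨ b = u

theorem Hang.conn {A C : Finset V} {u : V} (hA : Conn G A) (h : Hang G A C u) :
    Conn G (A \ C) := by
  obtain ⟨h1, h2, h3, h4, h5⟩ := h
  refine ⟨⟨u, Finset.mem_sdiff.2 ⟨h3, h4⟩⟩, fun E hE hEn hne => ?_⟩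
  have hEA : E ⊆ A := hE.trans Finset.sdiff_subset
  by_cases hu : u ∈ E
  · obtain ⟨a, ha, b, hb, hab⟩ := hA.2 (E ∪ C) (Finset.union_subset hEA h1)
      (hEn.mono Finset.subset_union_left) (fun e => hne (by
        rw [← e]; ext x
        simp only [Finset.mem_sdiff, Finset.mem_union]
        constructor
        · exact fun hx => ⟨Or.inl hx, (Finset.mem_sdiff.1 (hE hx)).2⟩
        · exact fun hx => hx.1.resolve_right hx.2))
    simp only [Finset.mem_union, Finset.mem_sdiff, not_or] at ha hb
    rcases ha with ha | ha
    · exact ⟨a, ha, b, by simp [hb], hab⟩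
    · rcases h5 a ha b hb.1 hab with hh | rfl
      · exact absurd hh hb.2.2
      · exact absurd hu hb.2.1
  · obtain ⟨a, ha, b, hb, hab⟩ := hA.2 E hEA hEn (fun e => hu (e ▸ h3))
    rw [Finset.mem_sdiff] at hb
    refine ⟨a, ha, b, Finset.mem_sdiff.2 ⟨Finset.mem_sdiff.2 ⟨hb.1, fun hbC => ?_⟩, hb.2⟩, hab⟩
    rcases h5 b hbC a (hEA ha) hab.symm with hh | rfl
    · exact (Finset.mem_sdiff.1 (hE ha)).2 hh
    · exact hu ha

theorem Comp.touch {A H C : Finset V} (hA : Conn G A) (hH : H ⊆ A) (hn : H.Nonempty)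
    (hC : Comp G (A \ H) C) : ∃ c ∈ C, ∃ h ∈ H, G.Adj c h := by
  obtain ⟨h1, h2, h3⟩ := hC
  obtain ⟨a, ha, b, hb, hab⟩ := hA.2 C (h1.trans Finset.sdiff_subset) h2.1 (fun e => by
    obtain ⟨x, hx⟩ := hn
    exact (Finset.mem_sdiff.1 (h1 (e ▸ hH hx))).2 hx)
  refine ⟨a, ha, b, ?_, hab⟩
  rw [Finset.mem_sdiff] at hb
  by_contra hbH
  exact hb.2 (h3 a ha b (Finset.mem_sdiff.2 ⟨hb.1, hbH⟩) hab)

/-- The indicator of a proposition. -/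
noncomputable def ind (p : Prop) : ℕ := if p then 1 else 0

theorem ind_pos {p : Prop} (h : p) : ind p = 1 := if_pos h
theorem ind_neg {p : Prop} (h : ¬ p) : ind p = 0 := if_neg h
theorem ind_le (p : Prop) : ind p ≤ 1 := by unfold ind; split_ifs <;> simp
theorem one_le_ind {p : Prop} : 1 ≤ ind p ↔ p := by unfold ind; split_ifs <;> simp [*]

theorem dg_singleton (u w : V) : dg G {u} w = ind (G.Adj u w) := by
  unfold dg ind
  rw [Finset.filter_singleton]
  split_ifs with h1 h2 h2
  · rfl
  · exact absurd h1.symm h2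
  · exact absurd h2.symm h1
  · rfl

theorem Hang.subset {A C : Finset V} {u : V} (h : Hang G A C u) : C ⊆ A := h.1

theorem Hang.toComp {A C C' : Finset V} {u : V} (h : Hang G A C u) (hC : Comp G C C') :
    Comp G (A \ {u}) C' ∧ Hang G A C' u := by
  obtain ⟨h1, h2, h3, h4, h5⟩ := h
  obtain ⟨c1, c2, c3⟩ := hC
  refine ⟨⟨fun x hx => ?_, c2, fun a ha b hb hab => ?_⟩, c1.trans h1, c2.1, h3,
    fun hu => h4 (c1 hu), fun a ha b hb hab => ?_⟩
  · rw [Finset.mem_sdiff, Finset.mem_singleton]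
    exact ⟨h1 (c1 hx), fun e => h4 (e ▸ c1 hx)⟩
  · rw [Finset.mem_sdiff, Finset.mem_singleton] at hb
    exact c3 a ha b ((h5 a (c1 ha) b hb.1 hab).resolve_right hb.2) hab
  · exact (h5 a (c1 ha) b hb hab).imp_left fun hbC => c3 a ha b hbC hab

theorem Comp.toHang {A C : Finset V} {u : V} (hu : u ∈ A) (hC : Comp G (A \ {u}) C) :
    Hang G A C u := by
  obtain ⟨c1, c2, c3⟩ := hC
  refine ⟨c1.trans Finset.sdiff_subset, c2.1, hu, fun h => by simpa using c1 h,
    fun a ha b hb hab => ?_⟩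
  by_cases e : b = u
  · exact Or.inr e
  · exact Or.inl (c3 a ha b (by simp [hb, e]) hab)

theorem Comp.disjoint {A H C : Finset V} (hC : Comp G (A \ H) C) : Disjoint C H :=
  Finset.disjoint_left.2 fun _ hx hx' => (Finset.mem_sdiff.1 (hC.1 hx)).2 hx'

theorem Comp.subset {A H C : Finset V} (hC : Comp G (A \ H) C) : C ⊆ A :=
  hC.1.trans Finset.sdiff_subset

theorem Comp.dg {A H C : Finset V} (hC : Comp G (A \ H) C) (hH : H ⊆ A) {w : V} (hw : w ∈ C) :
    dg G A w = dg G C w + dg G H w := by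
  rw [dg_eq_sdiff hH]
  congr 1
  refine le_antisymm (dg_le_of fun x hx hwx => hC.2.2 w hw x hx hwx) (dg_mono hC.1 _)

/-- A set hanging inside a component and not touching the deleted set hangs in the whole graph. -/
theorem Comp.hang {A H C E : Finset V} {v : V} (hC : Comp G (A \ H) C) (h : Hang G C E v)
    (ht : ∀ e ∈ E, ∀ x ∈ H, ¬ G.Adj e x) : Hang G A E v := by
  obtain ⟨h1, h2, h3, h4, h5⟩ := h
  refine ⟨h1.trans hC.subset, h2, hC.subset h3, h4, fun c hc b hb hcb => h5 c hc b ?_ hcb⟩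
  exact hC.2.2 c (h1 hc) b (Finset.mem_sdiff.2 ⟨hb, fun hbH => ht c hc b hbH hcb⟩) hcb

theorem LS.glue {A B : Finset V} {R : V → Prop} {u w : V} {m : ℕ} {r : V} (hr : R r)
    (h : PL G m A r u) (hd : Disjoint A B) {s : ℕ} (hs : s ∈ LS G B (G.Adj u) w) :
    s + (m + 1) ∈ LS G (A ∪ B) R w := by
  obtain ⟨x, hx, hp⟩ := hs
  refine ⟨r, hr, ?_⟩
  rw [add_comm]
  exact h.glue hp hd hx

/-- Roots `R` and targets `w` of weight `j w` in a connected set `A`; degrees, roots and weights add up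
to at least `D`, and every hanging set meets a root or a target. -/
structure Inst (G : SimpleGraph V) (A : Finset V) (R : V → Prop) (j : V → ℕ) (D : ℕ) : Prop where
  conn : Conn G A
  root : ∃ r ∈ A, R r
  wt : ∃ w ∈ A, 1 ≤ j w
  deg : ∀ w ∈ A, D ≤ dg G A w + ind (R w) + j w
  cut : ∀ C u, Hang G A C u → ∃ w ∈ C, R w ∨ 1 ≤ j w

/-- Some target `w` ends paths from the roots whose lengths contain a chain of `D - j w` terms. -/
def Good (G : SimpleGraph V) (A : Finset V) (R : V → Prop) (j : V → ℕ) (D : ℕ) : Prop :=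
  ∃ w ∈ A, 1 ≤ j w ∧ Chain (max 1 (D - j w)) (LS G A R w)

/-- Every instance on `A` has a long chain. -/
def Solve (G : SimpleGraph V) (A : Finset V) : Prop :=
  ∀ R j D, Inst G A R j D → Good G A R j D

/-- Reduced instances: the targets are plain, and no hanging set misses the roots or the targets. -/
structure Red (G : SimpleGraph V) (A R U : Finset V) (D : ℕ) : Prop where
  conn : Conn G A
  RA : R ⊆ A
  UA : U ⊆ A
  Rn : R.Nonempty
  Un : U.Nonempty
  D3 : 3 ≤ D
  deg : ∀ w ∈ A, D ≤ dg G A w + ind (w ∈ R) + ind (w ∈ U)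
  hangR : ∀ C u, Hang G A C u → ∃ w ∈ C, w ∈ R
  hangU : ∀ C u, Hang G A C u → ∃ w ∈ C, w ∈ U
  ih : ∀ E ⊂ A, Solve G E

/-- Some target ends paths from the roots whose lengths contain a chain of `D - 1` terms. -/
def LongChain (G : SimpleGraph V) (A R U : Finset V) (D : ℕ) : Prop :=
  ∃ w ∈ U, Chain (D - 1) (LS G A (· ∈ R) w)

theorem good_of_hang_root {A C : Finset V} {R : V → Prop} {j : V → ℕ} {D : ℕ} {u : V}
    (hI : Inst G A R j D) (ih : ∀ E ⊂ A, Solve G E) (h : Hang G A C u) (hR : ∀ c ∈ C, ¬ R c) :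
    Good G A R j D := by
  obtain ⟨c, hc⟩ := h.2.1
  obtain ⟨C', -, hC⟩ := exists_comp (G := G) hc
  obtain ⟨hK, hH⟩ := h.toComp hC
  have hR' : ∀ c ∈ C', ¬ R c := fun c hc => hR c (hC.1 hc)
  have huA : {u} ⊆ A := by simpa using h.2.2.1
  obtain ⟨a, ha, b, hb, hab⟩ := hK.touch hI.conn huA (by simp)
  rw [Finset.mem_singleton] at hb
  subst hb
  have hss : C' ⊂ A := ⟨hH.1, fun hh => hH.2.2.2.1 (hh hH.2.2.1)⟩
  obtain ⟨w, hw, hjw, hch⟩ := ih C' hss (G.Adj b) j D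
    { conn := hC.2.1
      root := ⟨a, ha, hab.symm⟩
      wt := by
        obtain ⟨w, hw, hh⟩ := hI.cut _ _ hH
        exact ⟨w, hw, hh.resolve_left (hR' w hw)⟩
      deg := fun w hw => by
        have := hI.deg w (hH.1 hw)
        rw [hK.dg huA hw, dg_singleton, ind_neg (hR' w hw)] at this
        omega
      cut := fun E v hE => by
        by_cases ht : ∃ e ∈ E, G.Adj b e
        · obtain ⟨e, he, hbe⟩ := ht
          exact ⟨e, he, Or.inl hbe⟩
        · push Not at ht
          obtain ⟨w, hw, hh⟩ := hI.cut E v (hK.hang hE (by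
            intro e he x hx
            rw [Finset.mem_singleton] at hx
            subst hx
            exact fun hh => ht e he hh.symm))
          exact ⟨w, hw, Or.inr (hh.resolve_left (hR' w (hE.1 hw)))⟩ }
  obtain ⟨r, hrA, hr⟩ := hI.root
  obtain ⟨m, hm⟩ := (hH.conn hI.conn).path (u := r) (v := b)
    (Finset.mem_sdiff.2 ⟨hrA, fun hh => hR' r hh hr⟩) (Finset.mem_sdiff.2 ⟨hH.2.2.1, hH.2.2.2.1⟩)
  refine ⟨w, hH.1 hw, hjw, hch.shift (m + 1) fun s hs => ?_⟩
  have := LS.glue hr hm Finset.sdiff_disjoint hs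
  rwa [Finset.sdiff_union_of_subset hH.1] at this

theorem fin_of_hang_target {A C : Finset V} {R : V → Prop} {U : V → Prop} {D : ℕ} {u : V}
    (hI : Inst G A R (fun w => ind (U w)) D) (ih : ∀ E ⊂ A, Solve G E) (h : Hang G A C u)
    (hangR : ∀ C u, Hang G A C u → ∃ w ∈ C, R w) (hU : ∀ c ∈ C, ¬ U c) :
    Good G A R (fun w => ind (U w)) D := by
  obtain ⟨c, hc⟩ := h.2.1
  obtain ⟨C', -, hC⟩ := exists_comp (G := G) hc
  obtain ⟨hK, hH⟩ := h.toComp hC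
  have hU' : ∀ c ∈ C', ¬ U c := fun c hc => hU c (hC.1 hc)
  have huA : {u} ⊆ A := by simpa using h.2.2.1
  obtain ⟨a, ha, b, hb, hab⟩ := hK.touch hI.conn huA (by simp)
  rw [Finset.mem_singleton] at hb
  subst hb
  have hss : C' ⊂ A := ⟨hH.1, fun hh => hH.2.2.2.1 (hh hH.2.2.1)⟩
  obtain ⟨w, hw, hjw, hch⟩ := ih C' hss R (dg G {b}) D
    { conn := hC.2.1
      root := hangR _ _ hH
      wt := ⟨a, ha, dg_pos.2 ⟨b, by simp, hab⟩⟩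
      deg := fun w hw => by
        have := hI.deg w (hH.1 hw)
        rw [hK.dg huA hw] at this
        simp only [ind_neg (hU' w hw)] at this
        omega
      cut := fun E v hE => by
        by_cases ht : ∃ e ∈ E, G.Adj e b
        · obtain ⟨e, he, hbe⟩ := ht
          exact ⟨e, he, Or.inr (dg_pos.2 ⟨b, by simp, hbe⟩)⟩
        · push Not at ht
          obtain ⟨w, hw, hh⟩ := hangR E v (hK.hang hE (by simpa using ht))
          exact ⟨w, hw, Or.inl hh⟩ }
  obtain ⟨x, hx, hwx⟩ := dg_pos.1 hjw
  rw [Finset.mem_singleton] at hx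
  subst hx
  obtain ⟨t, htA, ht⟩ := hI.wt
  have ht : U t := one_le_ind.1 ht
  obtain ⟨m, hm⟩ := (hH.conn hI.conn).path (u := x) (v := t)
    (Finset.mem_sdiff.2 ⟨hH.2.2.1, hH.2.2.2.1⟩) (Finset.mem_sdiff.2 ⟨htA, fun hh => hU' t hh ht⟩)
  rw [dg_singleton, ind_pos hwx.symm] at hch
  refine ⟨t, htA, one_le_ind.2 ht, ?_⟩
  simp only [ind_pos ht]
  refine hch.shift (1 + m) fun s hs => ?_
  obtain ⟨r, hr, hp⟩ := hs
  refine ⟨r, hr, ?_⟩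
  have := hp.glue hm Finset.disjoint_sdiff hwx
  rw [Finset.union_sdiff_of_subset hH.1] at this
  rwa [← add_assoc]

theorem solve_of_red (h : ∀ A R U D, Red G A R U D → LongChain G A R U D) (A : Finset V) :
    Solve G A := by
  induction A using Finset.strongInduction with
  | H A ih =>
  intro R j D hI
  by_cases c1 : ∃ C u, Hang G A C u ∧ ∀ c ∈ C, ¬ R c
  · obtain ⟨C, u, hh, hR⟩ := c1
    exact good_of_hang_root hI ih hh hR
  have hangR : ∀ C u, Hang G A C u → ∃ w ∈ C, R w := by
    intro C u hh
    by_contra hcon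
    push Not at hcon
    exact c1 ⟨C, u, hh, hcon⟩
  clear c1
  obtain ⟨w₀, hw₀, hmax⟩ := Finset.exists_max_image A j hI.conn.1
  have hp : 1 ≤ j w₀ := by
    obtain ⟨w, hw, hjw⟩ := hI.wt
    exact hjw.trans (hmax w hw)
  have hI' : Inst G A R (fun w => ind (j w = j w₀)) (D + 1 - j w₀) :=
    { conn := hI.conn
      root := hI.root
      wt := ⟨w₀, hw₀, one_le_ind.2 rfl⟩
      deg := fun w hw => by
        have h1 := hI.deg w hw
        have h2 := hmax w hw
        by_cases e : j w = j w₀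
        · simp only [ind_pos e]; omega
        · simp only [ind_neg e]; omega
      cut := fun C u hh => by
        obtain ⟨w, hw, hr⟩ := hangR C u hh
        exact ⟨w, hw, Or.inl hr⟩ }
  suffices hs : Good G A R (fun w => ind (j w = j w₀)) (D + 1 - j w₀) by
    obtain ⟨w, hw, h1, h2⟩ := hs
    have e := one_le_ind.1 h1
    refine ⟨w, hw, e ▸ hp, h2.mono ?_ subset_rfl⟩
    simp only [ind_pos e]
    omega
  generalize D + 1 - j w₀ = D at hI'
  generalize hU : (fun w => j w = j w₀) = U
  have hU' : (fun w => ind (j w = j w₀)) = fun w => ind (U w) := by rw [← hU]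
  rw [hU'] at hI' ⊢
  clear hU hU' hmax hp hI hw₀
  by_cases c1 : ∃ C u, Hang G A C u ∧ ∀ c ∈ C, ¬ U c
  · obtain ⟨C, u, hh, hR⟩ := c1
    exact fin_of_hang_target hI' ih hh hangR hR
  obtain ⟨r, hrA, hr⟩ := hI'.root
  obtain ⟨t, htA, ht⟩ := hI'.wt
  have ht := one_le_ind.1 ht
  by_cases hD : D ≤ 2
  · obtain ⟨m, hm⟩ := hI'.conn.path hrA htA
    refine ⟨t, htA, one_le_ind.2 ht, ?_⟩
    simp only [ind_pos ht]
    rw [show max 1 (D - 1) = 1 by omega]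
    exact chain_one ⟨r, hr, hm⟩
  have red : Red G A (A.filter R) (A.filter U) D :=
    { conn := hI'.conn
      RA := Finset.filter_subset _ _
      UA := Finset.filter_subset _ _
      Rn := ⟨r, by simp [hrA, hr]⟩
      Un := ⟨t, by simp [htA, ht]⟩
      D3 := by omega
      deg := fun w hw => by
        have := hI'.deg w hw
        simpa [hw] using this
      hangR := fun C u hh => by
        obtain ⟨w, hw, hr⟩ := hangR C u hh
        exact ⟨w, hw, by simp [hr, hh.1 hw]⟩
      hangU := fun C u hh => by
        by_contra hcon
        push Not at hcon
        refine c1 ⟨C, u, hh, fun w hw hu => hcon w hw ?_⟩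
        simp [hu, hh.1 hw]
      ih := ih }
  obtain ⟨w, hw, hch⟩ := h _ _ _ _ red
  rw [Finset.mem_filter] at hw
  refine ⟨w, hw.1, one_le_ind.2 hw.2, ?_⟩
  simp only [ind_pos hw.2]
  refine hch.mono (by omega) ?_
  rintro n ⟨r, hr, hp⟩
  exact ⟨r, (Finset.mem_filter.1 hr).2, hp⟩

theorem clique_path {K : Finset V} (hK : G.IsClique (K : Set V)) {u v : V} (hu : u ∈ K)
    (hv : v ∈ K) (huv : u ≠ v) {n : ℕ} (h1 : 1 ≤ n) (h2 : n < K.card) : PL G n K u v := by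
  induction n, h1 using Nat.le_induction generalizing K u with
  | base => exact PL.edge hu hv (hK hu hv huv)
  | succ n hn ih =>
    have hc : 0 < ((K.erase u).erase v).card := by
      have := Finset.card_erase_of_mem hu
      have := Finset.card_erase_of_mem (Finset.mem_erase.2 ⟨huv.symm, hv⟩)
      omega
    obtain ⟨x, hx⟩ := Finset.card_pos.1 hc
    simp only [Finset.mem_erase] at hx
    refine ⟨hu, x, hK hu hx.2.2 hx.2.1.symm, ih ?_ ?_ ?_ hx.1 ?_⟩
    · exact hK.subset (by simp)
    · simp [hx]
    · simp [hv, huv.symm]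
    · rw [Finset.card_erase_of_mem hu]; omega

theorem clique_gain_two {H : Finset V} (hH : G.IsClique (H : Set V)) {w : V} (hw : w ∉ H)
    (hd : 2 ≤ dg G H w) : ∃ u ∈ H, Chain H.card {n | PL G n (insert w H) w u} := by
  obtain ⟨u, hu, hwu⟩ := dg_pos.1 (show 1 ≤ dg G H w by omega)
  refine ⟨u, hu, ?_⟩
  have h3 : 1 < (H.filter fun x => G.Adj w x).card := hd
  obtain ⟨x, hx, hxu⟩ := Finset.exists_mem_ne h3 u
  rw [Finset.mem_filter] at hx
  refine chain_arith _ 1 1 le_rfl (by omega) fun i hi => ?_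
  rcases Nat.eq_zero_or_pos i with rfl | hi0
  · exact PL.edge (by simp) (by simp [hu]) hwu
  · have := (clique_path hH hx.1 hu hxu hi0 (by omega)).cons hw hx.2
    rwa [show 1 + 1 * i = i + 1 by omega]

theorem clique_gain {H : Finset V} (hH : G.IsClique (H : Set V)) {w : V} (hw : w ∉ H)
    (hd : 1 ≤ dg G H w) : ∃ u ∈ H, Chain (dg G H w) {n | PL G n (insert w H) w u} := by
  by_cases h2 : 2 ≤ dg G H w
  · obtain ⟨u, hu, hc⟩ := clique_gain_two hH hw h2
    exact ⟨u, hu, hc.mono (dg_le fun x hx _ => hx) subset_rfl⟩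
  · obtain ⟨u, hu, hwu⟩ := dg_pos.1 hd
    refine ⟨u, hu, ?_⟩
    rw [show dg G H w = 1 by omega]
    exact chain_one (Set.mem_ofPred.2 (PL.edge (by simp) (by simp [hu]) hwu))

theorem biclique_even {S T : Finset V} (hST : ∀ s ∈ S, ∀ t ∈ T, G.Adj s t) {i : ℕ}
    (h1 : i ≤ S.card) (h2 : i < T.card) {t : V} (ht : t ∈ T) :
    ∃ t' ∈ T, PL G (2 * i) (S ∪ T) t' t := by
  induction i generalizing S T t with
  | zero => exact ⟨t, ht, PL.refl (by simp [ht])⟩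
  | succ i ih =>
    obtain ⟨s, hs⟩ := Finset.card_pos.1 (show 0 < S.card by omega)
    obtain ⟨t₁, ht₁, hne⟩ := Finset.exists_mem_ne (show 1 < T.card by omega) t
    obtain ⟨t', ht', hp⟩ := ih (S := S.erase s) (T := T.erase t) (t := t₁)
      (fun a ha b hb => hST a (Finset.mem_of_mem_erase ha) b (Finset.mem_of_mem_erase hb))
      (by rw [Finset.card_erase_of_mem hs]; omega) (by rw [Finset.card_erase_of_mem ht]; omega)
      (by simp [ht₁, hne])
    have hst := hST s hs t ht
    have he : PL G 1 {s, t} s t := PL.edge (by simp) (by simp) hst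
    have hsT : s ∉ T := fun h => G.loopless.irrefl _ (hST s hs s h)
    have htS : t ∉ S := fun h => G.loopless.irrefl _ (hST t h t ht)
    refine ⟨t', Finset.mem_of_mem_erase ht', ?_⟩
    have := hp.glue he (by
      rw [Finset.disjoint_left]
      intro a ha hb
      simp only [Finset.mem_union, Finset.mem_erase, Finset.mem_insert, Finset.mem_singleton] at ha hb
      rcases hb with rfl | rfl
      · rcases ha with ha | ha
        · exact ha.1 rfl
        · exact hsT ha.2
      · rcases ha with ha | ha
        · exact htS ha.2
        · exact ha.1 rfl) (hST s hs t₁ ht₁).symm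
    refine PL.mono this ?_
    intro a ha
    simp only [Finset.mem_union, Finset.mem_erase, Finset.mem_insert, Finset.mem_singleton] at ha ⊢
    rcases ha with (ha | ha) | rfl | rfl
    · exact Or.inl ha.2
    · exact Or.inr ha.2
    · exact Or.inl hs
    · exact Or.inr ht

theorem biclique_odd {S T : Finset V} (hST : ∀ s ∈ S, ∀ t ∈ T, G.Adj s t) {i : ℕ}
    (h1 : i < S.card) (h2 : i < T.card) {s : V} (hs : s ∈ S) :
    ∃ t' ∈ T, PL G (2 * i + 1) (S ∪ T) t' s := by
  obtain ⟨t, ht⟩ := Finset.card_pos.1 (show 0 < T.card by omega)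
  obtain ⟨t', ht', hp⟩ := biclique_even (S := S.erase s) (T := T)
    (fun a ha b hb => hST a (Finset.mem_of_mem_erase ha) b hb)
    (show i ≤ _ by rw [Finset.card_erase_of_mem hs]; omega) h2 ht
  have hsT : s ∉ T := fun h => G.loopless.irrefl _ (hST s hs s h)
  refine ⟨t', ht', ?_⟩
  have := hp.glue (PL.refl (Finset.mem_singleton_self s)) (by simp [hsT]) (hST s hs t ht).symm
  refine PL.mono this ?_
  intro a ha
  simp only [Finset.mem_union, Finset.mem_erase, Finset.mem_singleton] at ha ⊢
  rcases ha with (ha | ha) | rfl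
  · exact Or.inl ha.2
  · exact Or.inr ha
  · exact Or.inl hs

/-- Solving `C` towards `H ∪ U` and finishing through the core `H`. -/
theorem target_core {C H U : Finset V} {R : V → Prop} {D : ℕ} (hC : Conn G C)
    (hd : Disjoint C H) (hS : Solve G C) (hR : ∃ c ∈ C, R c)
    (hdeg : ∀ w ∈ C, D ≤ dg G C w + ind (R w) + (dg G H w + ind (w ∈ U)))
    (hwt : ∃ w ∈ C, 1 ≤ dg G H w + ind (w ∈ U))
    (hcut : ∀ E v, Hang G C E v → ∃ w ∈ E, R w ∨ 1 ≤ dg G H w + ind (w ∈ U))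
    (hgain : ∀ w ∈ C, 1 ≤ dg G H w + ind (w ∈ U) →
      ∃ u ∈ U, Chain (dg G H w + ind (w ∈ U)) {n | PL G n (insert w H) w u}) :
    ∃ u ∈ U, Chain (D - 1) (LS G (C ∪ H) R u) := by
  obtain ⟨w, hw, hj, hc⟩ := hS R (fun w => dg G H w + ind (w ∈ U)) D
    ⟨hC, hR, hwt, hdeg, hcut⟩
  obtain ⟨u, hu, hg⟩ := hgain w hw hj
  refine ⟨u, hu, (Chain.add (T := LS G (C ∪ H) R u) (by omega) hj hc hg ?_).mono
    (by omega) subset_rfl⟩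
  rintro s ⟨r, hr, hp⟩ o ho
  refine ⟨r, hr, (hp.append ho ?_).mono ?_⟩
  · intro x hx hx'
    rw [Finset.mem_insert] at hx'
    exact hx'.resolve_right (Finset.disjoint_left.1 hd hx)
  · intro x hx
    simp only [Finset.mem_union, Finset.mem_insert] at hx ⊢
    rcases hx with hx | rfl | hx
    · exact Or.inl hx
    · exact Or.inl hw
    · exact Or.inr hx

variable {A R U : Finset V} {D : ℕ}

theorem Comp.ssubset {H C : Finset V} (hC : Comp G (A \ H) C) (hH : H ⊆ A) (hn : H.Nonempty) :
    C ⊂ A :=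
  ⟨hC.subset, fun h => by
    obtain ⟨x, hx⟩ := hn
    exact Finset.disjoint_left.1 hC.disjoint (h (hH hx)) hx⟩

theorem Red.target_core (h : Red G A R U D) {H : Finset V} (hH : H ⊆ A) (hn : H.Nonempty)
    (hR : ∃ r ∈ R, r ∉ H)
    (hgain : ∀ w ∈ A, w ∉ H → 1 ≤ dg G H w + ind (w ∈ U) →
      ∃ u ∈ U, Chain (dg G H w + ind (w ∈ U)) {n | PL G n (insert w H) w u}) :
    LongChain G A R U D := by
  obtain ⟨r, hr, hrH⟩ := hR
  obtain ⟨C, hrC, hC⟩ := exists_comp (G := G) (Finset.mem_sdiff.2 ⟨h.RA hr, hrH⟩)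
  obtain ⟨c, hc, x, hx, hcx⟩ := hC.touch h.conn hH hn
  have hsub : C ∪ H ⊆ A := Finset.union_subset hC.subset hH
  obtain ⟨u, hu, hch⟩ := EarCycles.target_core (G := G) (D := D) (U := U) (R := (· ∈ R))
    hC.2.1 hC.disjoint (h.ih C (hC.ssubset hH hn)) ⟨r, hrC, hr⟩
    (fun w hw => by
      have := h.deg w (hC.subset hw)
      rw [hC.dg hH hw] at this
      omega)
    ⟨c, hc, by have := dg_pos.2 ⟨x, hx, hcx⟩; omega⟩
    (fun E v hE => by
      by_cases ht : ∃ e ∈ E, ∃ x ∈ H, G.Adj e x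
      · obtain ⟨e, he, hh⟩ := ht
        exact ⟨e, he, Or.inr (by have := dg_pos.2 hh; omega)⟩
      · push Not at ht
        obtain ⟨w, hw, hwR⟩ := h.hangR E v (hC.hang hE ht)
        exact ⟨w, hw, Or.inl hwR⟩)
    (fun w hw => hgain w (hC.subset hw) (Finset.disjoint_left.1 hC.disjoint hw))
  exact ⟨u, hu, hch.mono le_rfl (LS.mono hsub)⟩

theorem Red.root_shift (h : Red G A R U D) {H C : Finset V} {ρ : V} (hρ : ρ ∈ R) (hH : H ⊆ A)
    (hρH : ρ ∉ H) (hC : Comp G (A \ insert ρ H) C) (ht : ∃ c ∈ C, G.Adj ρ c)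
    (hCR : ∀ c ∈ C, c ∉ R)
    (hgain : ∀ w ∈ A, w ∉ H → w ≠ ρ → 1 ≤ dg G H w + ind (w ∈ U) →
      ∃ u ∈ U, Chain (dg G H w + ind (w ∈ U)) {n | PL G n (insert w H) w u}) :
    LongChain G A R U D := by
  have hH' : insert ρ H ⊆ A := Finset.insert_subset (h.RA hρ) hH
  have hdis : Disjoint C H := hC.disjoint.mono_right (Finset.subset_insert _ _)
  have hρC : ρ ∉ C := fun hh => Finset.disjoint_left.1 hC.disjoint hh (by simp)
  have hsub : insert ρ (C ∪ H) ⊆ A :=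
    Finset.insert_subset (h.RA hρ) (Finset.union_subset hC.subset hH)
  obtain ⟨u, hu, hch⟩ := EarCycles.target_core (G := G) (D := D) (U := U) (R := G.Adj ρ)
    hC.2.1 hdis (h.ih C (hC.ssubset hH' (by simp))) ht
    (fun w hw => by
      have := h.deg w (hC.subset hw)
      rw [hC.dg hH' hw, ind_neg (hCR w hw), Finset.insert_eq, dg_union (by simpa using hρH),
        dg_singleton] at this
      omega)
    (by
      by_contra hcon
      push Not at hcon
      obtain ⟨w, hw, hwR⟩ := h.hangR C ρ ⟨hC.subset, hC.2.1.1, h.RA hρ, hρC, fun c hc b hb hcb => by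
        by_cases e : b = ρ
        · exact Or.inr e
        · refine Or.inl (hC.2.2 c hc b ?_ hcb)
          simp only [Finset.mem_sdiff, Finset.mem_insert, hb, e, false_or, true_and]
          intro hbH
          have := dg_pos.2 ⟨b, hbH, hcb⟩
          have := hcon c hc
          omega⟩
      exact hCR w hw hwR)
    (fun E v hE => by
      by_cases ht : ∃ e ∈ E, G.Adj ρ e
      · obtain ⟨e, he, hh⟩ := ht
        exact ⟨e, he, Or.inl hh⟩
      by_cases ht' : ∃ e ∈ E, ∃ x ∈ H, G.Adj e x
      · obtain ⟨e, he, hh⟩ := ht'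
        exact ⟨e, he, Or.inr (by have := dg_pos.2 hh; omega)⟩
      push Not at ht ht'
      obtain ⟨w, hw, hwR⟩ := h.hangR E v (hC.hang hE (by
        intro e he x hx
        rw [Finset.mem_insert] at hx
        rcases hx with rfl | hx
        · exact fun hh => ht e he hh.symm
        · exact ht' e he x hx))
      exact absurd hwR (hCR w (hE.1 hw)))
    (fun w hw => hgain w (hC.subset hw) (Finset.disjoint_left.1 hdis hw)
      (fun e => hρC (e ▸ hw)))
  refine ⟨u, hu, hch.shift 1 fun s hs => ?_⟩
  obtain ⟨r, hr, hp⟩ := hs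
  exact ⟨ρ, hρ, (hp.cons (by simp [hρC, hρH]) hr).mono hsub⟩

/-- Chains of paths `R → w` through `H` and of paths `w → b` through `E` combine. -/
theorem chain_through {H E B : Finset V} {R : V → Prop} {w b t : V} {a n m : ℕ} (ha : 1 ≤ a)
    (hn : 1 ≤ n) (h1 : Chain a (LS G (insert w H) R w)) (h2 : Chain n (LS G E (G.Adj b) w))
    (hw : w ∈ E) (hEH : Disjoint E H) (hm : PL G m B b t) (hB : Disjoint B (E ∪ H)) :
    Chain (a + n - 1) (LS G (E ∪ H ∪ B) R t) := by
  refine (h1.add (T := {l | l + (1 + m) ∈ LS G (E ∪ H ∪ B) R t}) ha hn h2 ?_).shift (1 + m)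
    fun s hs => hs
  rintro s ⟨r, hr, hp⟩ o ⟨x, hbx, hx⟩
  refine ⟨r, hr, ?_⟩
  have h3 : PL G (s + o) (E ∪ H) r x := by
    refine (hp.append hx.symm ?_).mono ?_
    · intro y hy hy'
      rw [Finset.mem_insert] at hy
      exact hy.resolve_right (Finset.disjoint_left.1 hEH hy')
    · intro y hy
      simp only [Finset.mem_union, Finset.mem_insert] at hy ⊢
      rcases hy with (rfl | hy) | hy
      · exact Or.inl hw
      · exact Or.inr hy
      · exact Or.inl hy
  have := h3.glue hm hB.symm hbx.symm
  rwa [← add_assoc]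

/-- Entering `C` from a core `H` through the exits `X`. -/
theorem root_core {C H X : Finset V} {R : V → Prop} {jC : V → ℕ} {D p : ℕ} (hC : Conn G C)
    (hd : Disjoint C H) (hS : ∀ E ⊆ C, Solve G E)
    (hX : ∃ c ∈ C, ∃ x ∈ X, G.Adj c x) (hU : ∃ c ∈ C, 1 ≤ jC c)
    (hdeg : ∀ w ∈ C, D ≤ dg G C w + dg G H w + ind (R w) + jC w) (hp : 1 ≤ p)
    (hloss : ∀ w ∈ C, dg G H w + ind (R w) ≤ p - 1 + ind (∃ x ∈ X, G.Adj w x))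
    (hpat : Pattern X (fun x => LS G H R x) p)
    (hbad : ∀ w ∈ C, (∀ x ∈ X, ¬ G.Adj w x) → 1 ≤ dg G H w + ind (R w) →
      Chain (dg G H w + ind (R w)) (LS G (insert w H) R w))
    (hcut : ∀ E v, Hang G C E v → ∃ w ∈ E, 1 ≤ dg G H w + ind (R w) + jC w) :
    ∃ w ∈ C, 1 ≤ jC w ∧ Chain (max 1 (D - jC w)) (LS G (C ∪ H) R w) := by
  by_cases hB : ∃ E v, Hang G C E v ∧ ∀ e ∈ E, jC e = 0 ∧ ∀ x ∈ X, ¬ G.Adj e x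
  · obtain ⟨E', u, hE', hb'⟩ := hB
    obtain ⟨e, he⟩ := hE'.2.1
    obtain ⟨E, -, hE⟩ := exists_comp (G := G) he
    obtain ⟨hK, hH⟩ := hE'.toComp hE
    have hb : ∀ e ∈ E, jC e = 0 ∧ ∀ x ∈ X, ¬ G.Adj e x := fun e he => hb' e (hE.1 he)
    have huC : {u} ⊆ C := by simpa using hH.2.2.1
    obtain ⟨a, ha, b, hbu, hab⟩ := hK.touch hC huC (by simp)
    rw [Finset.mem_singleton] at hbu
    subst hbu
    obtain ⟨w, hw, hjw, hch⟩ := hS E hH.1 (G.Adj b) (fun w => dg G H w + ind (R w)) D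
      { conn := hE.2.1
        root := ⟨a, ha, hab.symm⟩
        wt := by
          obtain ⟨w, hw, hh⟩ := hcut _ _ hH
          exact ⟨w, hw, by have := (hb w hw).1; omega⟩
        deg := fun w hw => by
          have := hdeg w (hH.1 hw)
          rw [hK.dg huC hw, dg_singleton, (hb w hw).1] at this
          omega
        cut := fun F v hF => by
          by_cases ht : ∃ e ∈ F, G.Adj b e
          · obtain ⟨e, he, hbe⟩ := ht
            exact ⟨e, he, Or.inl hbe⟩
          · push Not at ht
            obtain ⟨w, hw, hh⟩ := hcut F v (hK.hang hF (by
              intro e he x hx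
              rw [Finset.mem_singleton] at hx
              subst hx
              exact fun hh => ht e he hh.symm))
            exact ⟨w, hw, Or.inr (by have := (hb w (hF.1 hw)).1; omega)⟩ }
    have hg := hbad w (hH.1 hw) (hb w hw).2 hjw
    obtain ⟨t, htC, ht⟩ := hU
    obtain ⟨m, hm⟩ := (hH.conn hC).path (u := b) (v := t)
      (Finset.mem_sdiff.2 ⟨hH.2.2.1, hH.2.2.2.1⟩)
      (Finset.mem_sdiff.2 ⟨htC, fun hh => by have := (hb t hh).1; omega⟩)
    refine ⟨t, htC, ht, (chain_through hjw (by omega) hg hch hw (hd.mono_left hH.1) hm ?_).mono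
      (by omega) (LS.mono ?_)⟩
    · rw [Finset.disjoint_union_right]
      exact ⟨Finset.sdiff_disjoint, hd.mono_left Finset.sdiff_subset⟩
    · intro x hx
      simp only [Finset.mem_union, Finset.mem_sdiff] at hx ⊢
      rcases hx with (hx | hx) | hx
      · exact Or.inl (hH.1 hx)
      · exact Or.inr hx
      · exact Or.inl hx.1
  · push Not at hB
    obtain ⟨w, hw, hjw, hch⟩ := hS C subset_rfl (fun w => ∃ x ∈ X, G.Adj w x) jC (D - (p - 1))
      { conn := hC
        root := hX
        wt := hU
        deg := fun w hw => by
          have := hdeg w hw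
          have := hloss w hw
          omega
        cut := fun E v hE => by
          obtain ⟨e, he, hh⟩ := hB E v hE
          refine ⟨e, he, ?_⟩
          by_cases hj : jC e = 0
          · exact Or.inl (hh hj)
          · exact Or.inr (by omega) }
    have := hpat (max 1 (D - (p - 1) - jC w)) (by omega)
      (fun x => {l | ∃ r l', G.Adj x r ∧ PL G l' C r w ∧ l = l' + 1})
      (hch.shift 1 (by
        rintro s ⟨r, ⟨x, hx, hrx⟩, hp⟩
        exact ⟨x, hx, r, s, hrx.symm, hp, rfl⟩))
    refine ⟨w, hw, hjw, this.mono (by omega) ?_⟩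
    rintro _ ⟨x, hx, _, ⟨r, l, hxr, hl, rfl⟩, o, ⟨r', hr', ho⟩, rfl⟩
    refine ⟨r', hr', ?_⟩
    have := ho.glue hl hd.symm hxr
    rw [Finset.union_comm, show l + 1 + o = o + 1 + l by omega]
    exact this

theorem Red.root_core (h : Red G A R U D) {H X C : Finset V} {p : ℕ} (hH : H ⊆ A)
    (hC : Comp G (A \ H) C) (hXH : X ⊆ H) (hX : ∃ c ∈ C, ∃ x ∈ X, G.Adj c x) (hU : ∃ c ∈ C, c ∈ U)
    (hp : 1 ≤ p)
    (hloss : ∀ w ∈ C, dg G H w + ind (w ∈ R) ≤ p - 1 + ind (∃ x ∈ X, G.Adj w x))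
    (hpat : Pattern X (fun x => LS G H (· ∈ R) x) p)
    (hbad : ∀ w ∈ C, (∀ x ∈ X, ¬ G.Adj w x) → 1 ≤ dg G H w + ind (w ∈ R) →
      Chain (dg G H w + ind (w ∈ R)) (LS G (insert w H) (· ∈ R) w)) : LongChain G A R U D := by
  obtain ⟨c, hc, hcU⟩ := hU
  have hn : H.Nonempty := by
    obtain ⟨_, _, x, hx, _⟩ := hX
    exact ⟨x, hXH hx⟩
  obtain ⟨w, hw, hj, hch⟩ := EarCycles.root_core (G := G) (D := D) (R := (· ∈ R))
    (jC := fun w => ind (w ∈ U)) hC.2.1 hC.disjoint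
    (fun E hE => h.ih E (Finset.ssubset_of_subset_of_ssubset hE (hC.ssubset hH hn))) hX
    ⟨c, hc, one_le_ind.2 hcU⟩
    (fun w hw => by
      have := h.deg w (hC.subset hw)
      rwa [hC.dg hH hw] at this) hp hloss hpat hbad
    (fun E v hE => by
      by_cases ht : ∃ e ∈ E, ∃ x ∈ H, G.Adj e x
      · obtain ⟨e, he, hh⟩ := ht
        exact ⟨e, he, by have := dg_pos.2 hh; omega⟩
      · push Not at ht
        obtain ⟨w, hw, hwR⟩ := h.hangU E v (hC.hang hE ht)
        exact ⟨w, hw, by have := ind_pos hwR; omega⟩)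
  have hwU := one_le_ind.1 hj
  simp only [ind_pos hwU] at hch
  exact ⟨w, hwU, hch.mono (by omega) (LS.mono (Finset.union_subset hC.subset hH))⟩

theorem Red.single_target (h : Red G A R U D) {H X C : Finset V} {p : ℕ} {τ : V} (hτ : τ ∈ U)
    (hH : H ⊆ A) (hτH : τ ∉ H) (hC : Comp G (A \ insert τ H) C) (ht : ∃ c ∈ C, G.Adj c τ)
    (hCU : ∀ c ∈ C, c ∉ U) (hp : 1 ≤ p)
    (hloss : ∀ w ∈ C, dg G H w + ind (w ∈ R) ≤ p - 1 + ind (∃ x ∈ X, G.Adj w x))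
    (hpat : Pattern X (fun x => LS G H (· ∈ R) x) p)
    (hbad : ∀ w ∈ C, (∀ x ∈ X, ¬ G.Adj w x) → 1 ≤ dg G H w + ind (w ∈ R) →
      Chain (dg G H w + ind (w ∈ R)) (LS G (insert w H) (· ∈ R) w)) : LongChain G A R U D := by
  have hH' : insert τ H ⊆ A := Finset.insert_subset (h.UA hτ) hH
  have hdis : Disjoint C H := hC.disjoint.mono_right (Finset.subset_insert _ _)
  have hτC : τ ∉ C := fun hh => Finset.disjoint_left.1 hC.disjoint hh (by simp)
  have hss := hC.ssubset hH' (by simp)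
  have hdeg : ∀ w ∈ C, D ≤ dg G C w + dg G H w + ind (w ∈ R) + dg G {τ} w := fun w hw => by
    have := h.deg w (hC.subset hw)
    rw [hC.dg hH' hw, ind_neg (hCU w hw), Finset.insert_eq, dg_union (by simpa using hτH)] at this
    omega
  have hsub : C ∪ H ∪ {τ} ⊆ A := by
    refine Finset.union_subset (Finset.union_subset hC.subset hH) ?_
    simpa using h.UA hτ
  have hdτ : Disjoint (C ∪ H) {τ} := by simp [hτC, hτH]
  have hang : ∀ E v, Hang G C E v → ∃ e ∈ E, G.Adj e τ ∨ 1 ≤ dg G H e + ind (e ∈ R) := by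
    intro E v hE
    by_contra hcon
    push Not at hcon
    obtain ⟨w, hw, hwR⟩ := h.hangR E v (hC.hang hE (by
      intro e he x hx
      rw [Finset.mem_insert] at hx
      rcases hx with rfl | hx
      · exact (hcon e he).1
      · intro hh
        have := dg_pos.2 ⟨x, hx, hh⟩
        have := (hcon e he).2
        omega))
    have := (hcon w hw).2
    have := ind_pos hwR
    omega
  by_cases hX : ∃ c ∈ C, ∃ x ∈ X, G.Adj c x
  · obtain ⟨w, hw, hj, hch⟩ := EarCycles.root_core (G := G) (D := D) (R := (· ∈ R))
      (jC := dg G {τ}) hC.2.1 hdis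
      (fun E hE => h.ih E (Finset.ssubset_of_subset_of_ssubset hE hss)) hX
      (by
        obtain ⟨c, hc, hcτ⟩ := ht
        exact ⟨c, hc, dg_pos.2 ⟨τ, by simp, hcτ⟩⟩)
      hdeg hp hloss hpat hbad
      (fun E v hE => by
        obtain ⟨e, he, hh⟩ := hang E v hE
        refine ⟨e, he, ?_⟩
        rcases hh with hh | hh
        · have := dg_pos.2 ⟨τ, Finset.mem_singleton_self τ, hh⟩
          omega
        · omega)
    have hle : dg G {τ} w ≤ 1 := dg_singleton_le
    obtain ⟨x, hx, hwx⟩ := dg_pos.1 hj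
    rw [Finset.mem_singleton] at hx
    subst hx
    refine ⟨x, hτ, (hch.mono (m := D - 1) (by omega) subset_rfl).shift 1 ?_⟩
    rintro s ⟨r, hr, hs⟩
    exact ⟨r, hr, (hs.glue (PL.refl (Finset.mem_singleton_self x)) hdτ hwx).mono hsub⟩
  · push Not at hX
    obtain ⟨w, hw, hj, hch⟩ := h.ih C hss (G.Adj τ) (fun w => dg G H w + ind (w ∈ R)) D
      { conn := hC.2.1
        root := by
          obtain ⟨c, hc, hcτ⟩ := ht
          exact ⟨c, hc, hcτ.symm⟩
        wt := by
          by_contra hcon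
          push Not at hcon
          obtain ⟨w, hw, hwR⟩ := h.hangR C τ ⟨hC.subset, hC.2.1.1, h.UA hτ, hτC,
            fun c hc b hb hcb => by
              by_cases e : b = τ
              · exact Or.inr e
              · refine Or.inl (hC.2.2 c hc b ?_ hcb)
                simp only [Finset.mem_sdiff, Finset.mem_insert, hb, e, false_or, true_and]
                intro hbH
                have := dg_pos.2 ⟨b, hbH, hcb⟩
                have := hcon c hc
                omega⟩
          have := hcon w hw
          have := ind_pos hwR
          omega
        deg := fun w hw => by
          have := hdeg w hw
          rw [dg_singleton] at this
          omega
        cut := fun E v hE => by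
          obtain ⟨e, he, hh⟩ := hang E v hE
          exact ⟨e, he, hh.imp_left fun hh => hh.symm⟩ }
    have hg := hbad w hw (hX w hw) hj
    exact ⟨τ, hτ, (chain_through hj (by omega) hg hch hw hdis
      (PL.refl (Finset.mem_singleton_self τ)) hdτ.symm).mono (by omega) (LS.mono hsub)⟩

theorem dg_insert {A : Finset V} {x : V} (hx : x ∉ A) (w : V) :
    dg G (insert x A) w = ind (G.Adj w x) + dg G A w := by
  rw [Finset.insert_eq, dg_union (by simpa using hx), dg_singleton, G.adj_comm]

theorem dg_singleton' (u w : V) : dg G {u} w = ind (G.Adj w u) := by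
  rw [dg_singleton, G.adj_comm]

theorem dg_lt {K : Finset V} {w : V} (h : ∃ k ∈ K, ¬ G.Adj w k) : dg G K w + 1 ≤ K.card := by
  obtain ⟨k, hk, hwk⟩ := h
  refine Finset.card_lt_card ⟨Finset.filter_subset _ _, fun hh => ?_⟩
  exact hwk (Finset.mem_filter.1 (hh hk)).2

theorem dg_self_lt {K : Finset V} {w : V} (h : w ∈ K) : dg G K w + 1 ≤ K.card :=
  dg_lt ⟨w, h, G.loopless.irrefl w⟩

theorem exists_max_clique {B K₀ : Finset V} (h : K₀ ⊆ B) (hK : G.IsClique (K₀ : Set V)) :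
    ∃ K, K₀ ⊆ K ∧ K ⊆ B ∧ G.IsClique (K : Set V) ∧ ∀ x ∈ B, x ∉ K → ∃ k ∈ K, ¬ G.Adj x k := by
  obtain ⟨K, hK', hmax⟩ := Finset.exists_max_image
    (B.powerset.filter fun K => K₀ ⊆ K ∧ G.IsClique (K : Set V)) Finset.card
    ⟨K₀, by simp [h, hK]⟩
  simp only [Finset.mem_filter, Finset.mem_powerset] at hK' hmax
  refine ⟨K, hK'.2.1, hK'.1, hK'.2.2, fun x hx hxK => ?_⟩
  by_contra hcon
  push Not at hcon
  have := hmax (insert x K) ⟨Finset.insert_subset hx hK'.1,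
    hK'.2.1.trans (Finset.subset_insert _ _), by
      rw [Finset.coe_insert, SimpleGraph.isClique_insert]
      exact ⟨hK'.2.2, fun b hb _ => hcon b hb⟩⟩
  rw [Finset.card_insert_of_notMem hxK] at this
  omega

theorem Red.exists_root_ne (h : Red G A R U D) (x : V) : ∃ r ∈ R, r ≠ x := by
  by_contra hcon
  push Not at hcon
  obtain ⟨r, hr⟩ := h.Rn
  obtain rfl := hcon r hr
  have h1 := h.deg r (h.RA hr)
  have := ind_le (r ∈ R)
  have := ind_le (r ∈ U)
  have := h.D3
  obtain ⟨y, hy, hry⟩ := dg_pos.1 (show 1 ≤ dg G A r by omega)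
  obtain ⟨C, -, hC⟩ := exists_comp (G := G) (A := A \ {r}) (v := y) (by simp [hy, hry.ne'])
  obtain ⟨w, hw, hwR⟩ := h.hangR C r (hC.toHang (h.RA hr))
  have := hcon w hwR
  subst this
  simpa using hC.1 hw

theorem gain_one {H : Finset V} (hHU : H ⊆ U) {w : V}
    (h1 : dg G H w + ind (w ∈ U) = 1) :
    ∃ u ∈ U, Chain (dg G H w + ind (w ∈ U)) {n | PL G n (insert w H) w u} := by
  rw [h1]
  by_cases hw : w ∈ U
  · exact ⟨w, hw, chain_one (Set.mem_ofPred.2 (PL.refl (by simp)))⟩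
  · rw [ind_neg hw] at h1
    obtain ⟨u, hu, hwu⟩ := dg_pos.1 (show 1 ≤ dg G H w by omega)
    exact ⟨u, hHU hu, chain_one (Set.mem_ofPred.2 (PL.edge (by simp) (by simp [hu]) hwu))⟩

theorem Red.isolated_target (h : Red G A R U D) {u : V} (hu : u ∈ U)
    (hiso : ∀ x ∈ U, ¬ G.Adj u x) : LongChain G A R U D := by
  obtain ⟨r, hr, hru⟩ := h.exists_root_ne u
  refine h.target_core (H := {u}) (by simpa using h.UA hu) (by simp) ⟨r, hr, by simpa using hru⟩ ?_
  intro w hw hwu hd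
  refine gain_one (by simpa using hu) ?_
  rw [dg_singleton] at hd ⊢
  by_cases hwU : w ∈ U
  · rw [ind_neg (hiso w hwU), ind_pos hwU]
  · have := ind_le (G.Adj u w)
    rw [ind_neg hwU] at hd ⊢
    omega

theorem Red.clique_target (h : Red G A R U D) (hU : G.IsClique (U : Set V))
    (hR : ∃ r ∈ R, r ∉ U) : LongChain G A R U D := by
  refine h.target_core h.UA h.Un hR fun w hw hwu hd => ?_
  rw [ind_neg hwu, add_zero] at hd ⊢
  exact clique_gain hU hwu hd

theorem Red.root_edge (h : Red G A R U D) {x y : V} (hx : x ∈ R) (hy : y ∈ R)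
    (hxy : G.Adj x y) : LongChain G A R U D := by
  obtain ⟨H, h1, h2, h3, h4⟩ := exists_max_clique (G := G) (B := R) (K₀ := {x, y})
    (by intro z; simp only [Finset.mem_insert, Finset.mem_singleton]; rintro (rfl | rfl) <;> assumption)
    (by simpa [SimpleGraph.isClique_pair] using fun _ => hxy)
  have hr : 2 ≤ H.card := by
    have := Finset.card_le_card h1
    rwa [Finset.card_pair hxy.ne] at this
  have hHA := h2.trans h.RA
  have hlen : ∀ x ∈ H, ∀ i < H.card, i ∈ LS G H (· ∈ R) x := by
    intro x hx i hi
    rcases Nat.eq_zero_or_pos i with rfl | hi0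
    · exact ⟨x, h2 hx, PL.refl hx⟩
    · obtain ⟨y, hy, hyx⟩ := Finset.exists_mem_ne (show 1 < H.card by omega) x
      exact ⟨y, h2 hy, clique_path h3 hy hx hyx hi0 hi⟩
  have hxH : x ∈ H := h1 (by simp)
  by_cases hU : ∃ u ∈ U, u ∉ H
  · obtain ⟨u, hu, huH⟩ := hU
    obtain ⟨C, huC, hC⟩ := exists_comp (G := G) (Finset.mem_sdiff.2 ⟨h.UA hu, huH⟩)
    refine h.root_core hHA hC (X := H) (p := H.card) subset_rfl
      (hC.touch h.conn hHA ⟨x, hxH⟩) ⟨u, huC, hu⟩ (by omega) ?_ ?_ ?_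
    · intro w hw
      have hle : dg G H w ≤ H.card := dg_le fun x hx _ => hx
      have hwH := Finset.disjoint_left.1 hC.disjoint hw
      by_cases ht : ∃ x ∈ H, G.Adj w x
      · rw [ind_pos ht]
        by_cases hwR : w ∈ R
        · have := dg_lt (h4 w hwR hwH)
          rw [ind_pos hwR]; omega
        · rw [ind_neg hwR]; omega
      · have := ind_le (w ∈ R)
        have : dg G H w = 0 := dg_zero.2 (by push Not at ht; exact ht)
        omega
    · exact pattern_arith (by omega) 0 1 le_rfl (by omega) fun x hx i hi => by
        simpa using hlen x hx i hi
    · intro w hw ht hd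
      rw [dg_zero.2 ht, zero_add] at hd ⊢
      have hwR := one_le_ind.1 hd
      rw [ind_pos hwR]
      exact chain_one ⟨w, hwR, PL.refl (by simp)⟩
  · push Not at hU
    have hUc : G.IsClique (U : Set V) := h3.subset (by exact_mod_cast hU)
    by_cases hRU : ∃ r ∈ R, r ∉ U
    · exact h.clique_target hUc hRU
    push Not at hRU
    have e1 : H = R := subset_antisymm h2 (fun z hz => hU z (hRU z hz))
    have e2 : U = R := subset_antisymm (fun z hz => h2 (hU z hz)) hRU
    by_cases hA : A = R
    · refine ⟨x, e2 ▸ hx, ?_⟩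
      have hd := h.deg x (h.RA hx)
      have := ind_le (x ∈ R)
      have := ind_le (x ∈ U)
      have := dg_self_lt (G := G) (h.RA hx)
      have hc : A.card = H.card := by rw [hA, e1]
      refine chain_arith _ 0 1 le_rfl (by omega) fun i hi => ?_
      have := hlen x hxH i (by omega)
      exact LS.mono hHA (by simpa using this)
    · obtain ⟨ρ, hρ, c, hc, hρc⟩ := h.conn.2 R h.RA h.Rn (Ne.symm hA)
      obtain ⟨C, hcC, hC⟩ := exists_comp (G := G) hc
      have hins : insert ρ (R.erase ρ) = R := Finset.insert_erase hρ
      refine h.root_shift (H := R.erase ρ) (C := C) hρ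
        ((Finset.erase_subset _ _).trans h.RA) (by simp) (by rwa [hins]) ⟨c, hcC, hρc⟩
        (fun z hz => (Finset.mem_sdiff.1 (hC.1 hz)).2) ?_
      intro w hw hw1 hw2 hd
      have hwR : w ∉ R := fun hh => hw1 (by simp [hh, hw2])
      rw [e2] at hd ⊢
      rw [ind_neg hwR, add_zero] at hd ⊢
      obtain ⟨u, hu, hh⟩ := clique_gain (G := G) (H := R.erase ρ)
        ((e1 ▸ h3).subset (by simp)) hw1 hd
      exact ⟨u, Finset.mem_of_mem_erase hu, hh⟩

theorem Red.exists_root_notMem_clique (h : Red G A R U D)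
    (hR : ∀ x ∈ R, ∀ y ∈ R, ¬ G.Adj x y) {H : Finset V} (hH : G.IsClique (H : Set V)) :
    ∃ r ∈ R, r ∉ H := by
  obtain ⟨r, hr⟩ := h.Rn
  obtain ⟨s, hs, hsr⟩ := h.exists_root_ne r
  by_contra hcon
  push Not at hcon
  exact hR s hs r hr (hH (hcon s hs) (hcon r hr) hsr)

theorem Red.target_triangle (h : Red G A R U D) (hR : ∀ x ∈ R, ∀ y ∈ R, ¬ G.Adj x y)
    {K : Finset V} (hK : G.IsClique (K : Set V)) (hKU : K ⊆ U) (hc : 3 ≤ K.card) :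
    LongChain G A R U D := by
  obtain ⟨H, h1, h2, h3, h4⟩ := exists_max_clique hKU hK
  have hr : 3 ≤ H.card := hc.trans (Finset.card_le_card h1)
  refine h.target_core (h2.trans h.UA) (Finset.card_pos.1 (by omega))
    (h.exists_root_notMem_clique hR h3) fun w hw hwH hd => ?_
  by_cases hwU : w ∈ U
  · have hlt := dg_lt (h4 w hwU hwH)
    rcases Nat.lt_or_ge (dg G H w) 1 with h0 | h0
    · exact gain_one h2 (by rw [ind_pos hwU]; omega)
    · rw [ind_pos hwU]
      by_cases h5 : 2 ≤ dg G H w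
      · obtain ⟨u, hu, hch⟩ := clique_gain_two h3 hwH h5
        exact ⟨u, h2 hu, hch.mono hlt subset_rfl⟩
      · obtain ⟨u, hu, hwu⟩ := dg_pos.1 h0
        obtain ⟨y, hy, hyu⟩ := Finset.exists_mem_ne (show 1 < H.card by omega) u
        refine ⟨y, h2 hy, ?_⟩
        rw [show dg G H w + 1 = 2 by omega]
        exact chain_two
          (Set.mem_ofPred.2 ((clique_path h3 hu hy hyu.symm (n := 1) le_rfl (by omega)).cons hwH hwu))
          (Set.mem_ofPred.2 ((clique_path h3 hu hy hyu.symm (n := 2) (by omega) (by omega)).cons hwH hwu))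
          (by omega) (by omega)
  · rw [ind_neg hwU, add_zero] at hd ⊢
    obtain ⟨u, hu, hch⟩ := clique_gain h3 hwH hd
    exact ⟨u, h2 hu, hch⟩

theorem Red.target_path_aux (h : Red G A R U D) {a m b c : V} (hU : U = {a, m, b})
    (hmb : G.Adj m b) (hab : a ≠ b) (ham : a ≠ m) (hRU : R ⊆ U) (ha : a ∈ R) (hc : c ∈ A)
    (hcU : c ∉ U) (hac : G.Adj a c) : LongChain G A R U D := by
  obtain ⟨C, hcC, hC⟩ := exists_comp (G := G) (Finset.mem_sdiff.2 ⟨hc, hcU⟩)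
  have hcl : G.IsClique (({m, b} : Finset V) : Set V) := by
    simpa [SimpleGraph.isClique_pair] using fun _ => hmb
  have hsub : ({m, b} : Finset V) ⊆ U := by rw [hU]; exact Finset.subset_insert _ _
  refine h.root_shift (H := {m, b}) (C := C) ha (hsub.trans h.UA) (by simp [hab, ham])
    (by rwa [← hU]) ⟨c, hcC, hac⟩ (fun z hz hzR => (Finset.mem_sdiff.1 (hC.1 hz)).2 (hRU hzR)) ?_
  intro w hw hw1 hw2 hd
  have hwU : w ∉ U := by
    rw [hU, Finset.mem_insert, not_or]; exact ⟨hw2, hw1⟩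
  rw [ind_neg hwU, add_zero] at hd ⊢
  obtain ⟨u, hu, hh⟩ := clique_gain hcl hw1 hd
  exact ⟨u, hsub hu, hh⟩

theorem Red.target_path (h : Red G A R U D) (hR : ∀ x ∈ R, ∀ y ∈ R, ¬ G.Adj x y) {a m b : V}
    (hU : U = {a, m, b}) (ham : G.Adj a m) (hmb : G.Adj m b) (hab : a ≠ b) (hnab : ¬ G.Adj a b) :
    LongChain G A R U D := by
  have haU : a ∈ U := by simp [hU]
  have hmU : m ∈ U := by simp [hU]
  have hbU : b ∈ U := by simp [hU]
  by_cases hRU : ∃ r ∈ R, r ∉ U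
  · refine h.target_core h.UA h.Un hRU fun w hw hwU hd => ?_
    by_cases h1 : dg G U w + ind (w ∈ U) = 1
    · exact gain_one subset_rfl h1
    have hdU : dg G U w + ind (w ∈ U) = ind (G.Adj w a) + ind (G.Adj w m) + ind (G.Adj w b) := by
      rw [ind_neg hwU, hU, dg_insert (by simp [hab, ham.ne]), dg_insert (by simpa using hmb.ne),
        dg_singleton']
      omega
    have path : ∀ x ∈ U, ∀ y ∈ U, G.Adj w x → G.Adj x y → PL G 2 (insert w U) w y :=
      fun x hx y hy hwx hxy => (PL.edge hx hy hxy).cons hwU hwx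
    have one : ∀ x ∈ U, G.Adj w x → PL G 1 (insert w U) w x :=
      fun x hx hwx => PL.edge (by simp) (by simp [hx]) hwx
    have three : G.Adj w b → PL G 3 (insert w U) w a := fun hwb => by
      refine PL.cons (n := 2) ⟨hbU, m, hmb.symm, ?_⟩ hwU hwb
      exact PL.edge (by simp [hmU, hmb.ne]) (by simp [haU, hab]) ham.symm
    rw [hdU] at h1 hd ⊢
    by_cases ca : G.Adj w a <;> by_cases cm : G.Adj w m <;> by_cases cb : G.Adj w b <;>
      simp only [ind_pos, ind_neg, ca, cm, cb, not_false_eq_true] at h1 hd ⊢ <;>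
      try first | omega | exact absurd trivial h1
    · exact ⟨a, haU, chain_three (Set.mem_ofPred.2 (one a haU ca))
        (Set.mem_ofPred.2 (path m hmU a haU cm ham.symm)) (Set.mem_ofPred.2 (three cb))
        (by omega) (by omega) (by omega) (by omega)⟩
    · exact ⟨a, haU, chain_two (Set.mem_ofPred.2 (one a haU ca))
        (Set.mem_ofPred.2 (path m hmU a haU cm ham.symm)) (by omega) (by omega)⟩
    · exact ⟨a, haU, chain_two (Set.mem_ofPred.2 (one a haU ca)) (Set.mem_ofPred.2 (three cb))
        (by omega) (by omega)⟩
    · exact ⟨b, hbU, chain_two (Set.mem_ofPred.2 (one b hbU cb))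
        (Set.mem_ofPred.2 (path m hmU b hbU cm hmb)) (by omega) (by omega)⟩
  · push Not at hRU
    have ha : a ∈ R ∧ b ∈ R ∧ m ∉ R := by
      obtain ⟨r, hr, hrm⟩ := h.exists_root_ne m
      obtain ⟨s, hs, hsr⟩ := h.exists_root_ne r
      have h1 := hRU r hr
      have h2 := hRU s hs
      rw [hU] at h1 h2
      simp only [Finset.mem_insert, Finset.mem_singleton] at h1 h2
      have hsm : s ≠ m := by
        rintro rfl
        rcases h1 with rfl | rfl | rfl
        · exact hR _ hr _ hs ham
        · exact hrm rfl
        · exact hR _ hs _ hr hmb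
      have hm : m ∉ R := fun hm => by
        rcases h1 with rfl | rfl | rfl
        · exact hR _ hr _ hm ham
        · exact hrm rfl
        · exact hR _ hm _ hr hmb
      rcases h1 with rfl | rfl | rfl <;> rcases h2 with rfl | rfl | rfl <;>
        simp_all
    obtain ⟨haR, hbR, hmR⟩ := ha
    by_cases hA : A = U
    · have hd := h.deg b (h.RA hbR)
      rw [hA, hU, dg_insert (by simp [hab, ham.ne]), dg_insert (by simpa using hmb.ne),
        dg_singleton', ind_neg (fun hh => hnab hh.symm), ind_neg (G.loopless.irrefl b)] at hd
      have := ind_le (G.Adj b m)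
      have := ind_le (b ∈ R)
      have := ind_le (b ∈ ({a, m, b} : Finset V))
      refine ⟨b, hbU, Chain.mono (n := 2) ?_ (by omega) subset_rfl⟩
      refine chain_two (s := 0) (t := 2) ⟨b, hbR, PL.refl (h.UA hbU)⟩ ⟨a, haR, h.UA haU, m, ham, ?_⟩
        (by omega) (by omega)
      exact PL.edge (by simp [h.UA hmU, ham.ne']) (by simp [h.UA hbU, hab.symm]) hmb
    · obtain ⟨x, hx⟩ : (A \ U).Nonempty := by
        rw [Finset.sdiff_nonempty]
        exact fun hh => hA (subset_antisymm hh h.UA)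
      obtain ⟨C, hxC, hC⟩ := exists_comp (G := G) hx
      by_cases hta : ∃ c ∈ C, G.Adj a c
      · obtain ⟨c, hc, hac⟩ := hta
        exact h.target_path_aux hU hmb hab ham.ne hRU haR (hC.subset hc)
          (Finset.disjoint_left.1 hC.disjoint hc) hac
      by_cases htb : ∃ c ∈ C, G.Adj b c
      · obtain ⟨c, hc, hbc⟩ := htb
        refine h.target_path_aux (a := b) (m := m) (b := a) ?_ ham.symm hab.symm hmb.ne' hRU hbR
          (hC.subset hc) (Finset.disjoint_left.1 hC.disjoint hc) hbc
        rw [hU]; ext z; simp only [Finset.mem_insert, Finset.mem_singleton]; tauto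
      push Not at hta htb
      obtain ⟨w, hw, hwR⟩ := h.hangR C m ⟨hC.subset, hC.2.1.1, h.UA hmU,
        fun hh => Finset.disjoint_left.1 hC.disjoint hh hmU, fun c hc y hy hcy => by
          by_cases e : y ∈ U
          · rw [hU] at e
            simp only [Finset.mem_insert, Finset.mem_singleton] at e
            rcases e with rfl | rfl | rfl
            · exact absurd hcy.symm (hta c hc)
            · exact Or.inr rfl
            · exact absurd hcy.symm (htb c hc)
          · exact Or.inl (hC.2.2 c hc y (Finset.mem_sdiff.2 ⟨hy, e⟩) hcy)⟩
      exact absurd (hRU w hwR) (Finset.disjoint_left.1 hC.disjoint hw)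

theorem exists_adj_of_not_isolated (h : Red G A R U D) (hF : ¬ LongChain G A R U D) {u : V}
    (hu : u ∈ U) : ∃ x ∈ U, G.Adj u x := by
  by_contra hcon
  push Not at hcon
  exact hF (h.isolated_target hu hcon)

theorem Red.target_near_clique (h : Red G A R U D) (hR : ∀ x ∈ R, ∀ y ∈ R, ¬ G.Adj x y)
    {Q : Finset V} (hQ : G.IsClique (Q : Set V)) {t : V} (hU : U ⊆ insert t Q) :
    LongChain G A R U D := by
  by_contra hF
  have hcl : ¬ G.IsClique (U : Set V) := fun hc =>
    hF (h.clique_target hc (h.exists_root_notMem_clique hR hc))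
  have hQU : G.IsClique ((U.erase t : Finset V) : Set V) := by
    refine hQ.subset fun x hx => ?_
    have hx' := Finset.mem_erase.1 (Finset.mem_coe.1 hx)
    exact (Finset.mem_insert.1 (hU hx'.2)).resolve_left hx'.1
  have hcard : (U.erase t).card ≤ 2 := by
    by_contra hcon
    exact hF (h.target_triangle hR hQU (Finset.erase_subset _ _) (by omega))
  have ht : t ∈ U := by
    by_contra hcon
    rw [Finset.erase_eq_of_notMem hcon] at hQU
    exact hcl hQU
  obtain ⟨m, hm, htm⟩ := exists_adj_of_not_isolated h hF ht
  have hUe : U = insert t (U.erase t) := (Finset.insert_erase ht).symm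
  have hme : m ∈ U.erase t := Finset.mem_erase.2 ⟨htm.ne', hm⟩
  by_cases hx : ∃ x ∈ U.erase t, x ≠ m
  · obtain ⟨x, hxe, hxm⟩ := hx
    have he : U.erase t = {m, x} := by
      refine (Finset.eq_of_subset_of_card_le ?_ ?_).symm
      · intro y hy
        simp only [Finset.mem_insert, Finset.mem_singleton] at hy
        rcases hy with rfl | rfl <;> assumption
      · rw [Finset.card_pair hxm.symm]; exact hcard
    have hmx : G.Adj m x := hQU hme hxe hxm.symm
    have htx : ¬ G.Adj t x := by
      intro htx
      refine hcl ?_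
      rw [hUe, Finset.coe_insert, SimpleGraph.isClique_insert]
      refine ⟨hQU, fun b hb _ => ?_⟩
      rw [he] at hb
      simp only [Finset.coe_insert, Finset.coe_singleton, Set.mem_insert_iff,
        Set.mem_singleton_iff] at hb
      rcases hb with rfl | rfl <;> assumption
    exact hF (h.target_path hR (by rw [hUe, he]) htm hmx
      (fun e => by subst e; simp at hxe) htx)
  · push Not at hx
    refine hcl ?_
    rw [hUe, Finset.coe_insert, SimpleGraph.isClique_insert]
    exact ⟨hQU, fun b hb _ => hx b hb ▸ htm⟩

theorem Red.two_roots_triangle (h : Red G A R U D) (hR : ∀ x ∈ R, ∀ y ∈ R, ¬ G.Adj x y)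
    {t₁ t₂ z a : V} (ht₁ : t₁ ∈ R) (ht₂ : t₂ ∈ R) (hne : t₁ ≠ t₂) (hz : z ∈ A) (ha : a ∈ A)
    (h1 : G.Adj z t₁) (h2 : G.Adj z t₂) (h3 : G.Adj a z) (h4 : G.Adj a t₁) : LongChain G A R U D := by
  obtain ⟨Q, hsub, hQA, hQ, hmax⟩ := exists_max_clique (G := G) (B := A) (K₀ := {t₁, z, a})
    (by
      intro y
      simp only [Finset.mem_insert, Finset.mem_singleton]
      rintro (rfl | rfl | rfl)
      exacts [h.RA ht₁, hz, ha])
    (by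
      rw [SimpleGraph.isClique_iff, Finset.coe_insert, Finset.coe_insert, Finset.coe_singleton]
      intro x hx y hy hxy
      simp only [Set.mem_insert_iff, Set.mem_singleton_iff] at hx hy
      rcases hx with rfl | rfl | rfl <;> rcases hy with rfl | rfl | rfl <;>
        first | exact absurd rfl hxy | assumption | (apply SimpleGraph.Adj.symm; assumption))
  have hq : 3 ≤ Q.card := by
    have := Finset.card_le_card hsub
    rwa [Finset.card_eq_three.2 ⟨t₁, z, a, h1.ne', h4.ne', h3.ne', rfl⟩] at this
  have ht₁Q : t₁ ∈ Q := hsub (by simp)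
  have hzQ : z ∈ Q := hsub (by simp)
  have ht₂Q : t₂ ∉ Q := fun hh => hR _ ht₁ _ ht₂ (hQ ht₁Q hh hne)
  by_cases hU : U ⊆ insert t₂ Q
  · exact h.target_near_clique hR hQ hU
  obtain ⟨u, hu, huH⟩ := Finset.not_subset.1 hU
  obtain ⟨C, huC, hC⟩ := exists_comp (G := G) (Finset.mem_sdiff.2 ⟨h.UA hu, huH⟩)
  have hHA : insert t₂ Q ⊆ A := Finset.insert_subset (h.RA ht₂) hQA
  have hQH : Q ⊆ insert t₂ Q := Finset.subset_insert _ _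
  have small : ∀ w, (∀ x ∈ (insert t₂ Q).erase z, ¬ G.Adj w x) →
      dg G (insert t₂ Q) w = ind (G.Adj w z) := by
    intro w hw
    rw [← dg_singleton']
    refine dg_congr fun x hwx => ?_
    rw [Finset.mem_singleton]
    constructor
    · intro hx
      by_contra hxz
      exact hw x (Finset.mem_erase.2 ⟨hxz, hx⟩) hwx
    · rintro rfl
      exact hQH hzQ
  have zlen : ∀ n, 1 ≤ n → n < Q.card → n ∈ LS G (insert t₂ Q) (· ∈ R) z := fun n hn hn' =>
    ⟨t₁, ht₁, (clique_path hQ ht₁Q hzQ h1.ne' hn hn').mono hQH⟩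
  have long : ∀ x ∈ (insert t₂ Q).erase z, ∀ n, 2 ≤ n → n ≤ Q.card →
      n ∈ LS G (insert t₂ Q) (· ∈ R) x := by
    intro x hx n hn hn'
    obtain ⟨m, rfl⟩ : ∃ m, n = m + 1 := ⟨n - 1, by omega⟩
    rw [Finset.mem_erase, Finset.mem_insert] at hx
    rcases hx with ⟨hxz, rfl | hx⟩
    · refine ⟨t₁, ht₁, PL.symm ?_⟩
      exact (clique_path hQ hzQ ht₁Q h1.ne (n := m) (by omega) (by omega)).cons ht₂Q h2.symm
    · exact ⟨t₂, ht₂, (clique_path hQ hzQ hx (Ne.symm hxz) (n := m) (by omega) (by omega)).cons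
        ht₂Q h2.symm⟩
  have bad : ∀ w, w ∉ insert t₂ Q → dg G (insert t₂ Q) w = ind (G.Adj w z) →
      1 ≤ dg G (insert t₂ Q) w + ind (w ∈ R) →
      Chain (dg G (insert t₂ Q) w + ind (w ∈ R))
        (LS G (insert w (insert t₂ Q)) (· ∈ R) w) := by
    intro w hw hd hpos
    rw [hd] at hpos ⊢
    have l0 : w ∈ R → 0 ∈ LS G (insert w (insert t₂ Q)) (· ∈ R) w :=
      fun hh => ⟨w, hh, PL.refl (by simp)⟩
    have l2 : G.Adj w z → 2 ∈ LS G (insert w (insert t₂ Q)) (· ∈ R) w := fun hh =>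
      ⟨t₁, ht₁, PL.symm ((PL.edge (hQH hzQ) (hQH ht₁Q) h1).cons hw hh)⟩
    by_cases c1 : G.Adj w z <;> by_cases c2 : w ∈ R <;>
      simp only [ind_pos, ind_neg, c1, c2, not_false_eq_true] at hpos ⊢
    · exact chain_two (l0 c2) (l2 c1) (by omega) (by omega)
    · exact chain_one (l2 c1)
    · exact chain_one (l0 c2)
    · omega
  by_cases hX : ∃ c ∈ C, ∃ x ∈ (insert t₂ Q).erase z, G.Adj c x
  · refine h.root_core hHA hC (X := (insert t₂ Q).erase z) (p := Q.card) (Finset.erase_subset _ _)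
      hX ⟨u, huC, hu⟩ (by omega) ?_ ?_ ?_
    · intro w hw
      have hwH := Finset.disjoint_left.1 hC.disjoint hw
      by_cases ht : ∃ x ∈ (insert t₂ Q).erase z, G.Adj w x
      · rw [ind_pos ht, dg_insert ht₂Q]
        have hlt := dg_lt (hmax w (hC.subset hw) fun hh => hwH (hQH hh))
        by_cases hwR : w ∈ R
        · rw [ind_pos hwR, ind_neg (hR w hwR t₂ ht₂)]; omega
        · have := ind_le (G.Adj w t₂)
          rw [ind_neg hwR]; omega
      · push Not at ht
        have := ind_le (G.Adj w z)
        have := ind_le (w ∈ R)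
        rw [small w ht]; omega
    · refine pattern_of (by omega) Q.card fun x hx => ?_
      obtain ⟨e, he, hel⟩ : ∃ e ≤ 1, e ∈ LS G (insert t₂ Q) (· ∈ R) x := by
        by_cases hxR : x ∈ R
        · exact ⟨0, by omega, x, hxR, PL.refl (Finset.mem_of_mem_erase hx)⟩
        · rw [Finset.mem_erase, Finset.mem_insert] at hx
          have hxQ : x ∈ Q := hx.2.resolve_left fun e => hxR (e ▸ ht₂)
          exact ⟨1, le_rfl, t₁, ht₁, PL.edge (hQH ht₁Q) (hQH hxQ)
            (hQ ht₁Q hxQ fun e => hxR (e ▸ ht₁))⟩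
      refine ⟨fun i => if i = 0 then e else i + 1, fun i hi => ?_, fun i hi => ?_, ?_⟩
      · show (if i = 0 then e else i + 1) ∈ _
        split_ifs with hi0
        · exact hel
        · exact long x hx _ (by omega) (by omega)
      · simp only [Nat.succ_ne_zero, if_false]
        split_ifs <;> omega
      · simp only [show Q.card - 1 ≠ 0 by omega, if_false]
        omega
    · intro w hw ht
      exact bad w (Finset.disjoint_left.1 hC.disjoint hw) (small w ht)
  · push Not at hX
    obtain ⟨c, hc, x, hx, hcx⟩ := hC.touch h.conn hHA (by simp)
    have hxz : x = z := by
      by_contra hxz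
      exact hX c hc x (Finset.mem_erase.2 ⟨hxz, hx⟩) hcx
    subst hxz
    refine h.root_core hHA hC (X := {x}) (p := 2) (by simpa using Or.inr hzQ)
      ⟨c, hc, x, by simp, hcx⟩ ⟨u, huC, hu⟩ (by omega) ?_ ?_ ?_
    · intro w hw
      have := ind_le (w ∈ R)
      simp only [Finset.mem_singleton, exists_eq_left]
      rw [small w (hX w hw)]
      omega
    · refine pattern_arith (by omega) 1 1 le_rfl (by omega) fun y hy i hi => ?_
      rw [Finset.mem_singleton] at hy
      subst hy
      exact zlen _ (by omega) (by omega)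
    · intro w hw _
      exact bad w (Finset.disjoint_left.1 hC.disjoint hw) (small w (hX w hw))

theorem biclique_bad {S T : Finset V} {R : V → Prop} (hST : ∀ s ∈ S, ∀ t ∈ T, G.Adj s t)
    (hT : ∀ t ∈ T, R t) (hc : S.card ≤ T.card) {w : V} (hw : w ∉ S ∪ T)
    (hwT : ∀ t ∈ T, ¬ G.Adj w t) (hle : dg G (S ∪ T) w + ind (R w) ≤ S.card)
    (hpos : 1 ≤ dg G (S ∪ T) w + ind (R w)) :
    Chain (dg G (S ∪ T) w + ind (R w)) (LS G (insert w (S ∪ T)) R w) := by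
  have h0 : R w → 0 ∈ LS G (insert w (S ∪ T)) R w := fun hh => ⟨w, hh, PL.refl (by simp)⟩
  have h1 : 1 ≤ dg G (S ∪ T) w → ∀ i < S.card, 2 * i + 2 ∈ LS G (insert w (S ∪ T)) R w := by
    intro hd i hi
    obtain ⟨s, hs, hws⟩ := dg_pos.1 hd
    have hsS : s ∈ S := (Finset.mem_union.1 hs).resolve_right fun hh => hwT s hh hws
    obtain ⟨t, ht, hp⟩ := biclique_odd hST hi (by omega) hsS
    exact ⟨t, hT t ht, PL.symm (hp.symm.cons hw hws)⟩
  by_cases hwR : R w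
  · rw [ind_pos hwR] at hle ⊢
    refine chain_arith _ 0 2 (by omega) le_rfl fun i hi => ?_
    rcases Nat.eq_zero_or_pos i with rfl | hi0
    · exact h0 hwR
    · have := h1 (by omega) (i - 1) (by omega)
      rwa [show 2 * (i - 1) + 2 = 0 + 2 * i by omega] at this
  · rw [ind_neg hwR] at hle hpos ⊢
    refine chain_arith _ 2 2 (by omega) le_rfl fun i hi => ?_
    have := h1 (by omega) i (by omega)
    rwa [add_comm] at this

/-- The vertices of `R` adjacent to all of `S`. -/
noncomputable def completeTo (G : SimpleGraph V) (R S : Finset V) : Finset V :=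
  R.filter fun t => ∀ s ∈ S, G.Adj s t

theorem mem_completeTo {S : Finset V} {t : V} :
    t ∈ completeTo G R S ↔ t ∈ R ∧ ∀ s ∈ S, G.Adj s t := Finset.mem_filter

/-- Splitting off a hanging set containing targets at a cut vertex that sees two roots. -/
theorem Red.split_hang (h : Red G A R U D) {C : Finset V} {z : V} (hC : Hang G A C z)
    (hCc : Comp G (A \ {z}) C) (hU : ∃ c ∈ C, c ∈ U) (hd : 2 ≤ dg G (A \ C) z)
    (hRC : ∃ r ∈ R, r ∉ C) : LongChain G A R U D := by
  have hD := h.D3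
  have hzA : {z} ⊆ A := by simpa using hC.2.2.1
  have hnb : ∀ w ∈ A \ C, w ≠ z → ∀ x ∈ A, G.Adj w x → x ∉ C := by
    intro w hw hwz x hx hwx hxC
    rw [Finset.mem_sdiff] at hw
    rcases hC.2.2.2.2 x hxC w hw.1 hwx.symm with hh | hh
    exacts [hw.2 hh, hwz hh]
  have hss : A \ C ⊂ A := by
    refine ⟨Finset.sdiff_subset, fun hh => ?_⟩
    obtain ⟨c, hc⟩ := hC.2.1
    exact (Finset.mem_sdiff.1 (hh (hC.1 hc))).2 hc
  have hzC : z ∈ A \ C := Finset.mem_sdiff.2 ⟨hC.2.2.1, hC.2.2.2.1⟩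
  obtain ⟨w, hw, hj, hch⟩ := h.ih (A \ C) hss (· ∈ R)
    (fun w => if w = z then D - 2 else ind (w ∈ U)) D
    { conn := hC.conn h.conn
      root := by
        obtain ⟨r, hr, hrC⟩ := hRC
        exact ⟨r, Finset.mem_sdiff.2 ⟨h.RA hr, hrC⟩, hr⟩
      wt := ⟨z, hzC, by rw [if_pos rfl]; omega⟩
      deg := fun w hw => by
        by_cases e : w = z
        · subst e
          rw [if_pos rfl]
          omega
        · have := h.deg w (hss.1 hw)
          rw [dg_eq_sdiff hC.1, dg_zero.2 fun x hx hwx => hnb w hw e x (hC.1 hx) hwx hx] at this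
          rw [if_neg e]
          omega
      cut := fun E v hE => by
        by_cases hzE : z ∈ E
        · exact ⟨z, hzE, Or.inr (by rw [if_pos rfl]; omega)⟩
        · obtain ⟨w, hw, hwR⟩ := h.hangR E v ⟨hE.1.trans hss.1, hE.2.1, hss.1 hE.2.2.1, hE.2.2.2.1,
            fun c hc b hb hcb => hE.2.2.2.2 c hc b (Finset.mem_sdiff.2 ⟨hb,
              hnb c (hE.1 hc) (fun e => hzE (e ▸ hc)) b hb hcb⟩) hcb⟩
          exact ⟨w, hw, Or.inl hwR⟩ }
  by_cases e : w = z
  · subst e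
    simp only [if_true] at hch
    obtain ⟨c, hc, hcU⟩ := hU
    obtain ⟨a, ha, b, hb, hab⟩ := hCc.touch h.conn hzA (by simp)
    rw [Finset.mem_singleton] at hb
    subst hb
    obtain ⟨u, hu, hju, hchu⟩ := h.ih C (hCc.ssubset hzA (by simp)) (G.Adj b)
      (fun x => ind (x ∈ U)) (D - 1)
      { conn := hCc.2.1
        root := ⟨a, ha, hab.symm⟩
        wt := ⟨c, hc, one_le_ind.2 hcU⟩
        deg := fun x hx => by
          have := h.deg x (hC.1 hx)
          have := ind_le (x ∈ R)
          rw [hCc.dg hzA hx, dg_singleton] at *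
          omega
        cut := fun E v hE => by
          by_cases ht : ∃ e ∈ E, G.Adj b e
          · obtain ⟨e, he, hbe⟩ := ht
            exact ⟨e, he, Or.inl hbe⟩
          · push Not at ht
            obtain ⟨y, hy, hyU⟩ := h.hangU E v (hCc.hang hE (by
              intro e he x hx
              rw [Finset.mem_singleton] at hx
              subst hx
              exact fun hh => ht e he hh.symm))
            exact ⟨y, hy, Or.inr (one_le_ind.2 hyU)⟩ }
    have huU := one_le_ind.1 hju
    simp only [ind_pos huU] at hchu
    refine ⟨u, huU, ((hch.add (T := {l | l + 1 ∈ LS G A (· ∈ R) u}) (by omega) (by omega)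
      hchu ?_).mono (m := D - 1) (by omega) subset_rfl).shift 1 fun s hs => hs⟩
    rintro s ⟨r, hr, hp⟩ o ⟨x, hx, hp'⟩
    refine ⟨r, hr, ?_⟩
    have := hp.glue hp' Finset.sdiff_disjoint hx
    rw [Finset.sdiff_union_of_subset hC.1] at this
    rwa [show s + o + 1 = s + 1 + o by omega]
  · simp only [if_neg e] at hj hch
    have hwU := one_le_ind.1 hj
    rw [ind_pos hwU] at hch
    exact ⟨w, hwU, hch.mono (by omega) (LS.mono hss.1)⟩

theorem Red.bipartite (h : Red G A R U D) (hR : ∀ x ∈ R, ∀ y ∈ R, ¬ G.Adj x y)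
    (hC : ∀ t₁ ∈ R, ∀ t₂ ∈ R, t₁ ≠ t₂ → ∀ z ∈ A, ∀ a ∈ A, G.Adj z t₁ → G.Adj z t₂ → G.Adj a z →
      ¬ G.Adj a t₁)
    (hiso : ∀ u ∈ U, ∃ x ∈ U, G.Adj u x) : LongChain G A R U D := by
  have hR2 : 2 ≤ R.card := by
    obtain ⟨r, hr⟩ := h.Rn
    obtain ⟨s, hs, hsr⟩ := h.exists_root_ne r
    have : ({s, r} : Finset V) ⊆ R := by
      intro x; simp only [Finset.mem_insert, Finset.mem_singleton]; rintro (rfl | rfl) <;> assumption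
    have := Finset.card_le_card this
    rwa [Finset.card_pair hsr] at this
  obtain ⟨S, hS, hmax⟩ := Finset.exists_max_image
    ((A \ R).powerset.filter fun S => S.card + 1 ≤ (completeTo G R S).card)
    (fun S => 2 * S.card + ind (¬ U ⊆ S ∪ completeTo G R S))
    ⟨∅, Finset.mem_filter.2 ⟨by simp, by
      rw [show completeTo G R ∅ = R from Finset.filter_true_of_mem (by simp)]
      simp only [Finset.card_empty]
      omega⟩⟩
  simp only [Finset.mem_filter, Finset.mem_powerset] at hS hmax
  obtain ⟨hSA, hST⟩ := hS
  have hmax1 : ∀ S' ⊆ A \ R, S'.card + 1 ≤ (completeTo G R S').card → S'.card ≤ S.card := by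
    intro S' h1 h2
    have := hmax S' ⟨h1, h2⟩
    have := ind_le (¬ U ⊆ S ∪ completeTo G R S)
    omega
  have hmax2 : U ⊆ S ∪ completeTo G R S → ∀ S' ⊆ A \ R, S'.card + 1 ≤ (completeTo G R S').card →
      S'.card = S.card → U ⊆ S' ∪ completeTo G R S' := by
    intro hU S' h1 h2 h3
    have := hmax S' ⟨h1, h2⟩
    rw [ind_neg (not_not.2 hU)] at this
    by_contra hcon
    rw [ind_pos hcon] at this
    omega
  have noTouch : ∀ S' : Finset V, S' ⊆ A \ R → 2 ≤ (completeTo G R S').card → ∀ s ∈ S',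
      ∀ t ∈ completeTo G R S', ∀ a ∈ A, G.Adj a s → ¬ G.Adj a t := by
    intro S' h1 h2 s hs t ht a ha has
    obtain ⟨t', ht', hne⟩ := Finset.exists_mem_ne (show 1 < (completeTo G R S').card by omega) t
    have e1 := mem_completeTo.1 ht
    have e2 := mem_completeTo.1 ht'
    exact hC t e1.1 t' e2.1 hne.symm s (Finset.mem_sdiff.1 (h1 hs)).1 a ha (e1.2 s hs) (e2.2 s hs) has
  have extCard : ∀ S' : Finset V, S' ⊆ A \ R → ∀ w ∈ A, w ∉ S' → (∃ t ∈ completeTo G R S', G.Adj w t) →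
      insert w S' ⊆ A \ R ∧ w ∉ R ∧
        dg G (completeTo G R S') w ≤ (completeTo G R (insert w S')).card := by
    intro S' h1 w hw hwS ⟨t, ht, hwt⟩
    have hwR : w ∉ R := fun hh => hR w hh t (mem_completeTo.1 ht).1 hwt
    refine ⟨Finset.insert_subset (Finset.mem_sdiff.2 ⟨hw, hwR⟩) h1, hwR, ?_⟩
    refine dg_le fun x hx hwx => ?_
    rw [mem_completeTo] at hx ⊢
    refine ⟨hx.1, fun s hs => ?_⟩
    rw [Finset.mem_insert] at hs
    rcases hs with rfl | hs
    exacts [hwx, hx.2 s hs]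
  have hdis : ∀ S' : Finset V, S' ⊆ A \ R → Disjoint S' (completeTo G R S') := by
    intro S' h1
    rw [Finset.disjoint_left]
    exact fun x hx hx' => (Finset.mem_sdiff.1 (h1 hx)).2 (mem_completeTo.1 hx').1
  have dgS : ∀ S' : Finset V, S' ⊆ A \ R → 2 ≤ (completeTo G R S').card → ∀ w ∈ A,
      (∃ t ∈ completeTo G R S', G.Adj w t) → dg G S' w = 0 := by
    intro S' h1 h2 w hw ⟨t, ht, hwt⟩
    exact dg_zero.2 fun s hs hws => noTouch S' h1 h2 s hs t ht w hw hws hwt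
  have dgS' : ∀ S' : Finset V, ∀ w, w ∉ completeTo G R S' → dg G S' w + ind (w ∈ R) ≤ S'.card := by
    intro S' w hw
    by_cases hwR : w ∈ R
    · rw [ind_pos hwR]
      refine dg_lt ?_
      by_contra hcon
      push Not at hcon
      exact hw (mem_completeTo.2 ⟨hwR, fun s hs => (hcon s hs).symm⟩)
    · rw [ind_neg hwR]
      exact dg_le fun x hx _ => hx
  have hbic : ∀ S' : Finset V, ∀ s ∈ S', ∀ t ∈ completeTo G R S', G.Adj s t :=
    fun S' s hs t ht => (mem_completeTo.1 ht).2 s hs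
  have hTR : ∀ S' : Finset V, completeTo G R S' ⊆ R := fun S' => Finset.filter_subset _ _
  generalize hT : completeTo G R S = T at *
  have hSA' : S ⊆ A := hSA.trans Finset.sdiff_subset
  have hTA : T ⊆ A := hT ▸ (hTR S).trans h.RA
  have hHA : S ∪ T ⊆ A := Finset.union_subset hSA' hTA
  have hTR' : T ⊆ R := hT ▸ hTR S
  have hST' : ∀ s ∈ S, ∀ t ∈ T, G.Adj s t := hT ▸ hbic S
  have hdST : Disjoint S T := hT ▸ hdis S hSA
  have touchT : ∀ w ∈ A, w ∉ S → (∃ t ∈ T, G.Adj w t) →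
      w ∉ R ∧ dg G S w = 0 ∧ dg G T w ≤ S.card + 1 := by
    intro w hw hwS ht
    obtain ⟨e1, e2, e3⟩ := extCard S hSA w hw hwS (hT.symm ▸ ht)
    rw [hT] at e3
    refine ⟨e2, ?_, ?_⟩
    · by_cases h2 : 2 ≤ T.card
      · exact dgS S hSA (hT.symm ▸ h2) w hw (hT.symm ▸ ht)
      · have : S = ∅ := Finset.card_eq_zero.1 (by omega)
        subst this
        simp [dg]
    · by_contra hcon
      have := hmax1 _ e1 (by rw [Finset.card_insert_of_notMem hwS]; omega)
      rw [Finset.card_insert_of_notMem hwS] at this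
      omega
  have even : ∀ t ∈ T, ∀ i < S.card + 1, 0 + 2 * i ∈ LS G (S ∪ T) (· ∈ R) t := by
    intro t ht i hi
    obtain ⟨t', ht', hp⟩ := biclique_even hST' (i := i) (by omega) (by omega) ht
    exact ⟨t', hTR' ht', by rwa [zero_add]⟩
  by_cases hU : U ⊆ S ∪ T
  · have hU2 := hmax2 hU
    have hSS : ∀ s ∈ S, ∀ s' ∈ S, ¬ G.Adj s s' := by
      intro s hs s' hs' hss
      have hpos := Finset.card_pos.2 ⟨s, hs⟩
      obtain ⟨t, ht⟩ := Finset.card_pos.1 (show 0 < T.card by omega)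
      exact noTouch S hSA (by rw [hT]; omega) s hs t (hT.symm ▸ ht) s' (hSA' hs') hss.symm
        (hST' s' hs' t ht)
    obtain ⟨τ, hτU, hτT, z, hzU, hzS⟩ : ∃ τ ∈ U, τ ∈ T ∧ ∃ z ∈ U, z ∈ S := by
      obtain ⟨u, hu⟩ := h.Un
      obtain ⟨x, hx, hux⟩ := hiso u hu
      rcases Finset.mem_union.1 (hU hu) with h1 | h1 <;> rcases Finset.mem_union.1 (hU hx) with h2 | h2
      · exact absurd hux (hSS u h1 x h2)
      · exact ⟨x, hx, h2, u, hu, h1⟩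
      · exact ⟨u, hu, h1, x, hx, h2⟩
      · exact absurd hux (hR u (hTR' h1) x (hTR' h2))
    have hm := Finset.card_pos.2 ⟨z, hzS⟩
    have hD := h.D3
    by_cases hbig : S.card + 2 ≤ T.card
    · have hins : insert τ (S ∪ T.erase τ) = S ∪ T := by
        rw [← Finset.union_insert, Finset.insert_erase hτT]
      have hT'T := Finset.erase_subset τ T
      have hcard := Finset.card_erase_of_mem hτT
      have hτS : τ ∉ S := fun hh => Finset.disjoint_left.1 hdST hh hτT
      by_cases hc : ∃ c ∈ A \ (S ∪ T), G.Adj c τ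
      · obtain ⟨c, hc, hcτ⟩ := hc
        obtain ⟨C, hcC, hCc⟩ := exists_comp (G := G) hc
        rw [← hins] at hCc
        have hCH : ∀ w ∈ C, w ∉ S ∪ T := fun w hw => by
          rw [← hins]
          exact Finset.disjoint_left.1 hCc.disjoint hw
        have hdST' : Disjoint S (T.erase τ) := hdST.mono_right hT'T
        have dgN : ∀ w ∈ C, (∀ t ∈ T.erase τ, ¬ G.Adj w t) →
            dg G (S ∪ T.erase τ) w + ind (w ∈ R) ≤ S.card := by
          intro w hw ht
          rw [dg_union hdST', dg_zero.2 ht, add_zero]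
          exact dgS' S w fun hh => hCH w hw (Finset.mem_union_right _ (hT ▸ hh))
        refine h.single_target hτU ((Finset.union_subset_union_right hT'T).trans hHA)
          (by simp [hτS]) hCc ⟨c, hcC, hcτ⟩ (fun c hc hcU => hCH c hc (hU hcU))
          (X := T.erase τ) (p := S.card + 1) (by omega) ?_
          (pattern_arith (by omega) 0 2 (by omega) le_rfl fun t ht i hi => ?_) fun w hw ht =>
            biclique_bad (R := (· ∈ R)) (fun s hs t ht => hST' s hs t (hT'T ht))
              (fun t ht => hTR' (hT'T ht)) (by omega)
              (fun hh => hCH w hw (Finset.union_subset_union_right hT'T hh)) ht (dgN w hw ht)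
        · intro w hw
          by_cases ht : ∃ t ∈ T.erase τ, G.Adj w t
          · obtain ⟨t, ht1, ht2⟩ := ht
            obtain ⟨e1, e2, e3⟩ := touchT w (hCc.subset hw)
              (fun hh => hCH w hw (Finset.mem_union_left _ hh)) ⟨t, hT'T ht1, ht2⟩
            have := dg_mono (G := G) hT'T w
            rw [ind_pos (p := ∃ x ∈ T.erase τ, G.Adj w x) ⟨t, ht1, ht2⟩, dg_union hdST', ind_neg e1]
            omega
          · push Not at ht
            have := dgN w hw ht
            omega
        · obtain ⟨t', ht', hp⟩ := biclique_even (S := S) (T := T.erase τ)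
            (fun s hs t ht => hST' s hs t (hT'T ht)) (i := i) (by omega) (by omega) ht
          exact ⟨t', hTR' (hT'T ht'), by rwa [zero_add]⟩
      · push Not at hc
        have h1 : dg G A τ ≤ S.card := dg_le fun x hx hτx => by
          by_contra hxS
          by_cases hxT : x ∈ T
          · exact hR τ (hTR' hτT) x (hTR' hxT) hτx
          · exact hc x (by simp [hx, hxS, hxT]) hτx.symm
        have h2 := h.deg τ (h.UA hτU)
        have := ind_le (τ ∈ R)
        have := ind_le (τ ∈ U)
        exact ⟨τ, hτU, chain_arith _ 0 2 (by omega) le_rfl fun i hi =>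
          LS.mono hHA (even τ hτT i (by omega))⟩
    · have hS0A : S.erase z ⊆ A \ R := (Finset.erase_subset _ _).trans hSA
      have hcard := Finset.card_erase_of_mem hzS
      have hzR : z ∉ R := (Finset.mem_sdiff.1 (hSA hzS)).2
      have hTT : T ⊆ completeTo G R (S.erase z) := fun t ht => mem_completeTo.2
        ⟨hTR' ht, fun s hs => hST' s (Finset.mem_of_mem_erase hs) t ht⟩
      have hTc := Finset.card_le_card hTT
      have hd0 := hdis _ hS0A
      have hb0 := hbic (S.erase z)
      have hR0 := hTR (S.erase z)
      have hmem : ∀ x, x ∈ completeTo G R (S.erase z) → G.Adj z x → x ∈ T := by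
        intro x hx hzx
        rw [← hT]
        rw [mem_completeTo] at hx ⊢
        refine ⟨hx.1, fun s hs => ?_⟩
        by_cases e : s = z
        · exact e ▸ hzx
        · exact hx.2 s (Finset.mem_erase.2 ⟨e, hs⟩)
      have ext0 := extCard (S.erase z) hS0A
      have dg0 := dgS (S.erase z) hS0A (by omega)
      have dg0' := dgS' (S.erase z)
      have hzT0 : z ∉ completeTo G R (S.erase z) := fun hh => hzR (hR0 hh)
      generalize completeTo G R (S.erase z) = Tz at *
      have hzH : z ∉ S.erase z ∪ Tz := by simp [hzT0]
      have hHA0 : S.erase z ∪ Tz ⊆ A :=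
        Finset.union_subset (hS0A.trans Finset.sdiff_subset) (hR0.trans h.RA)
      have hsub : S ∪ T ⊆ insert z (S.erase z ∪ Tz) := by
        rw [← Finset.insert_union, Finset.insert_erase hzS]
        exact Finset.union_subset_union_right hTT
      by_cases hc : ∃ c ∈ A \ insert z (S.erase z ∪ Tz), G.Adj c z
      · obtain ⟨c, hc, hcz⟩ := hc
        obtain ⟨C, hcC, hCc⟩ := exists_comp (G := G) hc
        have hCH : ∀ w ∈ C, w ∉ insert z (S.erase z ∪ Tz) :=
          fun w hw => Finset.disjoint_left.1 hCc.disjoint hw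
        have hCT : ∀ w ∈ C, w ∉ Tz := fun w hw hh =>
          hCH w hw (Finset.mem_insert_of_mem (Finset.mem_union_right _ hh))
        have dgN : ∀ w ∈ C, (∀ t ∈ Tz, ¬ G.Adj w t) →
            dg G (S.erase z ∪ Tz) w + ind (w ∈ R) ≤ (S.erase z).card := by
          intro w hw ht
          rw [dg_union hd0, dg_zero.2 ht, add_zero]
          exact dg0' w (hCT w hw)
        refine h.single_target hzU hHA0 hzH hCc ⟨c, hcC, hcz⟩
          (fun c hc hcU => hCH c hc (hsub (hU hcU)))
          (X := Tz) (p := S.card) (by omega) ?_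
          (pattern_arith (by omega) 0 2 (by omega) le_rfl fun t ht i hi => ?_) fun w hw ht =>
            biclique_bad (R := (· ∈ R)) hb0 (fun t ht => hR0 ht) (by omega)
              (fun hh => hCH w hw (Finset.mem_insert_of_mem hh)) ht (dgN w hw ht)
        · intro w hw
          by_cases ht : ∃ t ∈ Tz, G.Adj w t
          · have hwS : w ∉ S.erase z := fun hh =>
              hCH w hw (Finset.mem_insert_of_mem (Finset.mem_union_left _ hh))
            obtain ⟨e1, e2, e3⟩ := ext0 w (hCc.subset hw) hwS ht
            rw [ind_pos ht, dg_union hd0, ind_neg e2, dg0 w (hCc.subset hw) ht]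
            by_contra hcon
            have hci := Finset.card_insert_of_notMem hwS
            have hz := hU2 _ e1 (by omega) (by omega) hzU
            rcases Finset.mem_union.1 hz with hz | hz
            · rcases Finset.mem_insert.1 hz with rfl | hz
              · exact hCH z hw (Finset.mem_insert_self _ _)
              · exact Finset.notMem_erase z S hz
            · exact hzR (hTR _ hz)
          · push Not at ht
            have := dgN w hw ht
            omega
        · obtain ⟨t', ht', hp⟩ := biclique_even hb0 (i := i) (by omega) (by omega) ht
          exact ⟨t', hR0 ht', by rwa [zero_add]⟩
      · push Not at hc
        have h1 : dg G A z ≤ T.card := dg_le fun x hx hzx => by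
          by_contra hxT
          refine hc x (Finset.mem_sdiff.2 ⟨hx, fun hh => ?_⟩) hzx.symm
          rcases Finset.mem_insert.1 hh with rfl | hh
          · exact G.loopless.irrefl _ hzx
          rcases Finset.mem_union.1 hh with hh | hh
          · exact hSS z hzS x (Finset.mem_of_mem_erase hh) hzx
          · exact hxT (hmem x hh hzx)
        have h2 := h.deg z (h.UA hzU)
        rw [ind_neg hzR] at h2
        have := ind_le (z ∈ U)
        exact ⟨τ, hτU, chain_arith _ 0 2 (by omega) le_rfl fun i hi =>
          LS.mono hHA (even τ hτT i (by omega))⟩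
  · obtain ⟨u, hu, huH⟩ := Finset.not_subset.1 hU
    obtain ⟨C, huC, hCc⟩ := exists_comp (G := G) (Finset.mem_sdiff.2 ⟨h.UA hu, huH⟩)
    have hCH : ∀ w ∈ C, w ∉ S ∪ T := fun w hw => Finset.disjoint_left.1 hCc.disjoint hw
    have hCS : ∀ w ∈ C, w ∉ S := fun w hw hh => hCH w hw (Finset.mem_union_left _ hh)
    have hCT : ∀ w ∈ C, w ∉ T := fun w hw hh => hCH w hw (Finset.mem_union_right _ hh)
    have dgN : ∀ w ∈ C, (∀ t ∈ T, ¬ G.Adj w t) → dg G (S ∪ T) w = dg G S w ∧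
        dg G S w + ind (w ∈ R) ≤ S.card := by
      intro w hw ht
      refine ⟨?_, dgS' S w (hT.symm ▸ hCT w hw)⟩
      rw [dg_union hdST, dg_zero.2 ht, add_zero]
    have hbad : ∀ w ∈ C, (∀ t ∈ T, ¬ G.Adj w t) → 1 ≤ dg G (S ∪ T) w + ind (w ∈ R) →
        Chain (dg G (S ∪ T) w + ind (w ∈ R)) (LS G (insert w (S ∪ T)) (· ∈ R) w) := by
      intro w hw ht hpos
      obtain ⟨e1, e2⟩ := dgN w hw ht
      exact biclique_bad (R := (· ∈ R)) hST' (fun t ht => hTR' ht) (by omega) (hCH w hw) ht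
        (by rw [e1]; exact e2) hpos
    have hTn : T.Nonempty := Finset.card_pos.1 (by omega)
    obtain ⟨c, hc, x, hx, hcx⟩ := hCc.touch h.conn hHA (hTn.mono Finset.subset_union_right)
    by_cases ht : ∃ c ∈ C, ∃ t ∈ T, G.Adj c t
    · refine h.root_core hHA hCc (X := T) (p := S.card + 1) Finset.subset_union_right ht
        ⟨u, huC, hu⟩ (by omega) ?_ (pattern_arith (by omega) 0 2 (by omega) le_rfl even) hbad
      intro w hw
      by_cases hwt : ∃ t ∈ T, G.Adj w t
      · obtain ⟨e1, e2, e3⟩ := touchT w (hCc.subset hw) (hCS w hw) hwt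
        rw [dg_union hdST, ind_neg e1, ind_pos hwt]
        omega
      · push Not at hwt
        obtain ⟨e1, e2⟩ := dgN w hw hwt
        omega
    · push Not at ht
      have hxS : x ∈ S := (Finset.mem_union.1 hx).resolve_right fun hh => ht c hc x hh hcx
      by_cases hm : 2 ≤ S.card
      · refine h.root_core hHA hCc (X := S) (p := S.card) Finset.subset_union_left
          ⟨c, hc, x, hxS, hcx⟩ ⟨u, huC, hu⟩ (by omega) ?_
          (pattern_arith (by omega) 1 2 (by omega) le_rfl ?_) (fun w hw _ => hbad w hw (ht w hw))
        · intro w hw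
          obtain ⟨e1, e2⟩ := dgN w hw (ht w hw)
          by_cases hwt : ∃ t ∈ S, G.Adj w t
          · rw [ind_pos hwt]
            omega
          · have := ind_le (w ∈ R)
            push Not at hwt
            rw [dg_zero.2 hwt] at e1
            omega
        · intro s hs i hi
          obtain ⟨t', ht', hp⟩ := biclique_odd hST' (i := i) (by omega) (by omega) hs
          exact ⟨t', hTR' ht', by rwa [add_comm]⟩
      · have hS1 : S = {x} := by
          have := Finset.card_pos.2 ⟨x, hxS⟩
          obtain ⟨y, hy⟩ := Finset.card_eq_one.1 (show S.card = 1 by omega)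
          rw [hy] at hxS ⊢
          rw [Finset.mem_singleton.1 hxS]
        have hSc : S.card = 1 := by rw [hS1]; simp
        have hxC : x ∉ C := fun hh => hCS x hh hxS
        have hCx : Comp G (A \ {x}) C := by
          refine ⟨fun y hy => ?_, hCc.2.1, fun a ha b hb hab => ?_⟩
          · rw [Finset.mem_sdiff, Finset.mem_singleton]
            exact ⟨hCc.subset hy, fun e => hxC (e ▸ hy)⟩
          · rw [Finset.mem_sdiff, ← hS1] at hb
            refine hCc.2.2 a ha b (Finset.mem_sdiff.2 ⟨hb.1, fun hh => ?_⟩) hab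
            rcases Finset.mem_union.1 hh with hh | hh
            exacts [hb.2 hh, ht a ha b hh hab]
        obtain ⟨t, htT⟩ := hTn
        refine h.split_hang (hCx.toHang (hSA' hxS)) hCx ⟨u, huC, hu⟩ ?_
          ⟨t, hTR' htT, fun hh => hCT t hh htT⟩
        refine le_trans (b := T.card) (by omega) (Finset.card_le_card fun y hy => ?_)
        rw [Finset.mem_filter, Finset.mem_sdiff]
        exact ⟨⟨hTA hy, fun hh => hCT y hh hy⟩, hST' x hxS y hy⟩

theorem Red.longChain (h : Red G A R U D) : LongChain G A R U D := by
  by_contra hF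
  refine hF (h.bipartite (fun x hx y hy hxy => hF (h.root_edge hx hy hxy)) ?_ ?_)
  · intro t₁ h1 t₂ h2 hne z hz a ha hz1 hz2 haz hat
    exact hF (h.two_roots_triangle (fun x hx y hy hxy => hF (h.root_edge hx hy hxy)) h1 h2 hne hz ha
      hz1 hz2 haz hat)
  · exact fun u hu => exists_adj_of_not_isolated h hF hu

theorem solve (A : Finset V) : Solve G A :=
  solve_of_red (fun _ _ _ _ h => h.longChain) A

theorem PL.cycle {n : ℕ} {A : Finset V} {u v : V} (h : PL G n A u v) (hn : 2 ≤ n)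
    (ha : G.Adj v u) : HasCycleLength G (n + 1) := by
  obtain ⟨p, hp, -, rfl⟩ := h.toWalk
  refine ⟨v, .cons ha p, (SimpleGraph.Walk.cons_isCycle_iff p ha).2 ⟨hp, fun hh => ?_⟩, by simp⟩
  have h1 := hp.eq_snd_of_mem_edges (Sym2.eq_swap ▸ hh)
  have h2 : p.getVert 1 = p.getVert p.length := by
    rw [SimpleGraph.Walk.getVert_length]
    exact h1.symm
  have := hp.getVert_injOn (show 1 ∈ {i | i ≤ p.length} by simp; omega)
    (show p.length ∈ {i | i ≤ p.length} by simp) h2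
  omega

theorem clique_cycle {K : Finset V} (hK : G.IsClique (K : Set V)) {n : ℕ} (h1 : 3 ≤ n)
    (h2 : n ≤ K.card) : HasCycleLength G n := by
  obtain ⟨u, hu⟩ := Finset.card_pos.1 (show 0 < K.card by omega)
  obtain ⟨v, hv, hne⟩ := Finset.exists_mem_ne (show 1 < K.card by omega) u
  obtain ⟨m, rfl⟩ : ∃ m, n = m + 1 := ⟨n - 1, by omega⟩
  exact (clique_path hK hu hv hne.symm (n := m) (by omega) (by omega)).cycle (by omega)
    (hK hv hu hne)

theorem one_lt_dg {K : Finset V} {w : V} (h : 1 < dg G K w) :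
    ∃ x ∈ K, ∃ y ∈ K, x ≠ y ∧ G.Adj w x ∧ G.Adj w y := by
  obtain ⟨x, hx, y, hy, hxy⟩ := Finset.one_lt_card.1 h
  rw [Finset.mem_filter] at hx hy
  exact ⟨x, hx.1, y, hy.1, hxy, hx.2, hy.2⟩

variable [Fintype V]

theorem exists_adj_ne (h : TwoConnected G) {C : Finset V} {v : V} (hC : C.Nonempty)
    (hv : v ∉ C) (hx : ∃ x, x ∉ C ∧ x ≠ v) : ∃ a ∈ C, ∃ b, b ∉ C ∧ b ≠ v ∧ G.Adj a b := by
  obtain ⟨c, hc⟩ := hC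
  obtain ⟨x, hxC, hxv⟩ := hx
  obtain ⟨p⟩ := (h.2 v).preconnected ⟨c, fun e => hv (by rw [Set.mem_singleton_iff] at e; rwa [← e])⟩ ⟨x, hxv⟩
  obtain ⟨d, -, h1, h2⟩ := p.exists_boundary_dart {y | (y : V) ∈ C} hc hxC
  exact ⟨d.fst, h1, d.snd, h2, d.snd.2, d.adj⟩

theorem Comp.touch_ne (h : TwoConnected G) {C K : Finset V} (hC : Comp G (Finset.univ \ K) C)
    {v : V} (hv : v ∈ K) (hK : 1 < K.card) : ∃ c ∈ C, ∃ x ∈ K, x ≠ v ∧ G.Adj c x := by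
  have hCK : ∀ x ∈ K, x ∉ C := fun x hx hh => Finset.disjoint_left.1 hC.disjoint hh hx
  obtain ⟨x, hx, hxv⟩ := Finset.exists_mem_ne hK v
  obtain ⟨a, ha, b, hb, hbv, hab⟩ := exists_adj_ne h hC.2.1.1 (hCK v hv) ⟨x, hCK x hx, hxv⟩
  refine ⟨a, ha, b, ?_, hbv, hab⟩
  by_contra hbK
  exact hb (hC.2.2 a ha b (by simp [hbK]) hab)

/-- Ears through a component `C` of the complement of `K`, closed up inside `K`. -/
theorem consecutive_of_ears (h : TwoConnected G) {K A B C : Finset V} {D m d k : ℕ}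
    (hC : Comp G (Finset.univ \ K) C) (hA : A ⊆ K) (hAB : Disjoint A B)
    (hCA : ∃ c ∈ C, ∃ x ∈ A, G.Adj c x) (hCB : ∃ c ∈ C, ∃ x ∈ B, G.Adj c x)
    (hdeg : ∀ w ∈ C, D ≤ dg G C w + ind (∃ x ∈ A, G.Adj w x) + ind (∃ x ∈ B, G.Adj w x))
    (htouch : ∀ w ∈ C, ∀ x ∈ K, G.Adj w x → ∃ y ∈ A ∪ B, G.Adj w y)
    (hm : 2 ≤ m) (hpath : ∀ a ∈ A, ∀ b ∈ B, ∀ i < m, PL G (d + i) K b a)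
    (hk : k ≤ max 1 (D - 1) + m - 1) : ∃ ℓ, ∀ i < k, HasCycleLength G (ℓ + i) := by
  have hCK : ∀ x ∈ K, x ∉ C := fun x hx hh => Finset.disjoint_left.1 hC.disjoint hh hx
  obtain ⟨c₀, hc₀, a₀, ha₀, hca⟩ := hCA
  obtain ⟨c₁, hc₁, b₀, hb₀, hcb⟩ := hCB
  have hab : ∀ a ∈ A, ∀ b ∈ B, b ≠ a := fun a ha b hb e => Finset.disjoint_left.1 hAB ha (e ▸ hb)
  have hd : 1 ≤ d := by
    by_contra hd
    have := hpath a₀ ha₀ b₀ hb₀ 0 (by omega)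
    obtain rfl : d = 0 := by omega
    exact hab a₀ ha₀ b₀ hb₀ this.2
  obtain ⟨w, hw, hj, hch⟩ := solve (G := G) C (fun w => ∃ x ∈ A, G.Adj w x)
    (fun w => ind (∃ x ∈ B, G.Adj w x)) D
    { conn := hC.2.1
      root := ⟨c₀, hc₀, a₀, ha₀, hca⟩
      wt := ⟨c₁, hc₁, one_le_ind.2 ⟨b₀, hb₀, hcb⟩⟩
      deg := hdeg
      cut := fun E v hE => by
        have hEK : ∀ x ∈ K, x ∉ E := fun x hx hh => hCK x hx (hE.1 hh)
        obtain ⟨a, ha, b, hb, hbv, hab'⟩ := exists_adj_ne h hE.2.1 hE.2.2.2.1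
          ⟨a₀, hEK a₀ (hA ha₀), fun e => hCK a₀ (hA ha₀) (e ▸ hE.2.2.1)⟩
        have hbK : b ∈ K := by
          by_contra hbK
          have := hC.2.2 a (hE.1 ha) b (by simp [hbK]) hab'
          rcases hE.2.2.2.2 a ha b this hab' with hh | hh
          exacts [hb hh, hbv hh]
        obtain ⟨y, hy, hay⟩ := htouch a (hE.1 ha) b hbK hab'
        rcases Finset.mem_union.1 hy with hy | hy
        · exact ⟨a, ha, Or.inl ⟨y, hy, hay⟩⟩
        · exact ⟨a, ha, Or.inr (one_le_ind.2 ⟨y, hy, hay⟩)⟩ }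
  have hwB := one_le_ind.1 hj
  simp only [ind_pos hwB] at hch
  obtain ⟨b, hb, hwb⟩ := hwB
  obtain ⟨s₀, hs⟩ := hch.fill hm (by omega)
  refine ⟨s₀ + d + 2, fun i hi => ?_⟩
  obtain ⟨s, ⟨r, ⟨a, ha, hra⟩, hp⟩, o, ho, e⟩ := hs i (by omega)
  have := (hp.glue (hpath a ha b hb o ho) (Finset.disjoint_of_subset_left subset_rfl hC.disjoint)
    hwb).cycle (by omega) hra.symm
  rwa [show s₀ + d + 2 + i = s + 1 + (d + o) + 1 by omega]

theorem exists_outside {K : Finset V} (h : K ≠ Finset.univ) :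
    ∃ C, Comp G (Finset.univ \ K) C := by
  obtain ⟨v, hv⟩ : ∃ v, v ∉ K := by
    by_contra hh
    push Not at hh
    exact h (Finset.eq_univ_of_forall hh)
  obtain ⟨C, -, hC⟩ := exists_comp (G := G) (A := Finset.univ \ K) (v := v) (by simp [hv])
  exact ⟨C, hC⟩

theorem ne_univ_of_dg {K : Finset V} {v : V} {k : ℕ} (hd : k ≤ dg G Finset.univ v)
    (h : dg G K v < k) : K ≠ Finset.univ := by
  rintro rfl
  omega

/-- Closing up through a clique split into two parts. -/
theorem consecutive_of_clique (h : TwoConnected G) {K A B C : Finset V} {D k : ℕ}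
    (hK : G.IsClique (K : Set V)) (hK3 : 3 ≤ K.card)
    (hC : Comp G (Finset.univ \ K) C) (hAB : Disjoint A B) (hABK : A ∪ B = K)
    (hCA : ∃ c ∈ C, ∃ x ∈ A, G.Adj c x) (hCB : ∃ c ∈ C, ∃ x ∈ B, G.Adj c x)
    (hdeg : ∀ w ∈ C, D ≤ dg G C w + ind (∃ x ∈ A, G.Adj w x) + ind (∃ x ∈ B, G.Adj w x))
    (hk : k ≤ max 1 (D - 1) + (K.card - 1) - 1) : ∃ ℓ, ∀ i < k, HasCycleLength G (ℓ + i) := by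
  have hA : A ⊆ K := hABK ▸ Finset.subset_union_left
  have hB : B ⊆ K := hABK ▸ Finset.subset_union_right
  refine consecutive_of_ears h hC hA hAB hCA hCB hdeg (fun w _ x hx hwx => ⟨x, hABK ▸ hx, hwx⟩)
    (m := K.card - 1) (d := 1) (by omega) (fun a ha b hb i hi => ?_) hk
  exact clique_path hK (hB hb) (hA ha) (fun e => Finset.disjoint_left.1 hAB ha (e ▸ hb))
    (by omega) (by omega)

theorem Comp.split (h : TwoConnected G) {C K : Finset V} (hC : Comp G (Finset.univ \ K) C)
    (hK : 1 < K.card) : ∃ x ∈ K, ∃ y ∈ K, x ≠ y ∧ (∃ c ∈ C, G.Adj c x) ∧ ∃ c ∈ C, G.Adj c y := by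
  obtain ⟨v, hv⟩ := Finset.card_pos.1 (show 0 < K.card by omega)
  obtain ⟨c, hc, x, hx, -, hcx⟩ := hC.touch_ne h hv hK
  obtain ⟨c', hc', y, hy, hyx, hcy⟩ := hC.touch_ne h hx hK
  exact ⟨x, hx, y, hy, hyx.symm, ⟨c, hc, hcx⟩, c', hc', hcy⟩

theorem consecutive_of_large_clique (h : TwoConnected G) {K : Finset V} {k : ℕ} (hk : 2 ≤ k)
    (hK : G.IsClique (K : Set V)) (hKk : k + 1 ≤ K.card) (hne : K ≠ Finset.univ) :
    ∃ ℓ, ∀ i < k, HasCycleLength G (ℓ + i) := by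
  obtain ⟨C, hC⟩ := exists_outside (G := G) hne
  obtain ⟨x, hx, y, hy, hxy, ⟨c, hc, hcx⟩, c', hc', hcy⟩ := hC.split h (by omega)
  refine consecutive_of_clique h (A := {x}) (B := K.erase x) (D := 0) hK (by omega) hC (by simp)
    (by rw [← Finset.insert_eq, Finset.insert_erase hx]) ⟨c, hc, x, by simp, hcx⟩
    ⟨c', hc', y, by simp [hy, hxy.symm], hcy⟩ (fun _ _ => Nat.zero_le _) (by omega)

theorem consecutive_of_maximal_clique (h : TwoConnected G) {K : Finset V} {k : ℕ}
    (hdeg : ∀ v, k ≤ dg G Finset.univ v) (hK : G.IsClique (K : Set V)) (h4 : 4 ≤ K.card)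
    (hKk : K.card ≤ k) (hmax : ∀ w, w ∉ K → ∃ x ∈ K, ¬ G.Adj w x) :
    ∃ ℓ, ∀ i < k, HasCycleLength G (ℓ + i) := by
  obtain ⟨v, hv⟩ := Finset.card_pos.1 (show 0 < K.card by omega)
  obtain ⟨C, hC⟩ := exists_outside (G := G) (ne_univ_of_dg (hdeg v)
    (lt_of_lt_of_le (dg_self_lt hv) hKk))
  obtain ⟨x, hx, y, hy, hxy, ⟨c, hc, hcx⟩, c', hc', hcy⟩ := hC.split h (by omega)
  obtain ⟨x', hx', hx'x⟩ := Finset.exists_mem_ne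
    (show 1 < (K.erase y).card by rw [Finset.card_erase_of_mem hy]; omega) x
  rw [Finset.mem_erase] at hx'
  have hsub : {x, x'} ⊆ K := by
    intro z; simp only [Finset.mem_insert, Finset.mem_singleton]
    rintro (rfl | rfl)
    exacts [hx, hx'.2]
  have hcA : ({x, x'} : Finset V).card = 2 := Finset.card_pair hx'x.symm
  have hcB := Finset.card_sdiff_of_subset hsub
  refine consecutive_of_clique h (A := {x, x'}) (B := K \ {x, x'}) (D := k - K.card + 3) hK
    (by omega) hC Finset.disjoint_sdiff (Finset.union_sdiff_of_subset hsub)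
    ⟨c, hc, x, by simp, hcx⟩ ⟨c', hc', y, by simp [hy, hxy.symm, hx'.1.symm], hcy⟩ ?_ (by omega)
  intro w hw
  have h1 := hdeg w
  rw [hC.dg (Finset.subset_univ _) hw, dg_eq_sdiff hsub] at h1
  have h2 := dg_lt (hmax w fun hh => Finset.disjoint_left.1 hC.disjoint hw hh)
  rw [dg_eq_sdiff hsub] at h2
  have h3 : dg G {x, x'} w ≤ 2 := hcA ▸ dg_le fun x hx _ => hx
  have h4 : dg G (K \ {x, x'}) w ≤ K.card - 2 := (dg_le fun x hx _ => hx).trans (by omega)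
  by_cases e1 : ∃ z ∈ ({x, x'} : Finset V), G.Adj w z <;>
    by_cases e2 : ∃ z ∈ K \ {x, x'}, G.Adj w z
  · rw [ind_pos e1, ind_pos e2]; omega
  · rw [ind_pos e1, ind_neg e2]; push Not at e2; rw [dg_zero.2 e2] at h1; omega
  · rw [ind_neg e1, ind_pos e2]; push Not at e1; rw [dg_zero.2 e1] at h1; omega
  · rw [ind_neg e1, ind_neg e2]; push Not at e1 e2; rw [dg_zero.2 e1, dg_zero.2 e2] at h1; omega

theorem consecutive_of_triangle (h : TwoConnected G) {K : Finset V} {k : ℕ} (hk : 3 ≤ k)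
    (hdeg : ∀ v, k ≤ dg G Finset.univ v) (hK : G.IsClique (K : Set V)) (h3 : K.card = 3)
    (hmax : ∀ w, w ∉ K → dg G K w ≤ 1) :
    ∃ ℓ, ∀ i < k, HasCycleLength G (ℓ + i) := by
  obtain ⟨v, hv⟩ := Finset.card_pos.1 (show 0 < K.card by omega)
  obtain ⟨C, hC⟩ := exists_outside (G := G) (ne_univ_of_dg (hdeg v)
    (lt_of_lt_of_le (dg_self_lt hv) (by omega)))
  obtain ⟨x, hx, y, hy, hxy, ⟨c, hc, hcx⟩, c', hc', hcy⟩ := hC.split h (by omega)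
  refine consecutive_of_clique h (A := {x}) (B := K.erase x) (D := k) hK (by omega) hC (by simp)
    (by rw [← Finset.insert_eq, Finset.insert_erase hx]) ⟨c, hc, x, by simp, hcx⟩
    ⟨c', hc', y, by simp [hy, hxy.symm], hcy⟩ (fun w hw => ?_) (by omega)
  have h1 := hdeg w
  rw [hC.dg (Finset.subset_univ _) hw] at h1
  have h2 := hmax w fun hh => Finset.disjoint_left.1 hC.disjoint hw hh
  by_cases e : 1 ≤ dg G K w
  · obtain ⟨z, hz, hwz⟩ := dg_pos.1 e
    by_cases hzx : z = x
    · rw [ind_pos (p := ∃ y ∈ ({x} : Finset V), G.Adj w y) ⟨z, by simp [hzx], hwz⟩]; omega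
    · rw [ind_pos (p := ∃ y ∈ K.erase x, G.Adj w y) ⟨z, by simp [hzx, hz], hwz⟩]; omega
  · omega

/-- Two triangles `a b c` and `a' b c` sharing an edge. -/
theorem consecutive_of_diamond (h : TwoConnected G) {a a' b c : V} {k : ℕ} (hk : 3 ≤ k)
    (hdeg : ∀ v, k ≤ dg G Finset.univ v) (hfree : ∀ K : Finset V, G.IsClique (K : Set V) → K.card ≤ 3)
    (haa : a ≠ a') (hbc : G.Adj b c) (hab : G.Adj a b) (hac : G.Adj a c) (hab' : G.Adj a' b)
    (hac' : G.Adj a' c) : ∃ ℓ, ∀ i < k, HasCycleLength G (ℓ + i) := by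
  have h4 : ∀ x y z w, G.Adj x y → G.Adj x z → G.Adj x w → G.Adj y z → G.Adj y w → ¬ G.Adj z w := by
    intro x y z w h1 h2 h3 h4 h5 h6
    have := hfree {x, y, z, w} (by
      simp only [Finset.coe_insert, Finset.coe_singleton, SimpleGraph.isClique_insert]
      simp [h1, h2, h3, h4, h5, h6])
    rw [Finset.card_insert_of_notMem (by simp [h1.ne, h2.ne, h3.ne]),
      Finset.card_insert_of_notMem (by simp [h4.ne, h5.ne]), Finset.card_pair h6.ne] at this
    omega
  have hnaa : ¬ G.Adj a a' := fun hh => h4 a a' b c hh hab hac hab' hac' hbc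
  have hdis : Disjoint ({a, a'} : Finset V) {b, c} := by
    simp [hab.ne, hac.ne, hab'.ne, hac'.ne, Finset.disjoint_left]
  have hmA : ∀ w, ind (∃ x ∈ ({a, a'} : Finset V), G.Adj w x) = ind (G.Adj w a ∨ G.Adj w a') := by
    intro w; simp
  have hmB : ∀ w, ind (∃ x ∈ ({b, c} : Finset V), G.Adj w x) = ind (G.Adj w b ∨ G.Adj w c) := by
    intro w; simp
  have hdK : ∀ w, dg G ({a, a'} ∪ {b, c}) w =
      ind (G.Adj w a) + ind (G.Adj w a') + (ind (G.Adj w b) + ind (G.Adj w c)) := by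
    intro w
    rw [dg_union hdis, dg_insert (by simpa using haa), dg_insert (by simpa using hbc.ne),
      dg_singleton', dg_singleton']
  obtain ⟨C, hC⟩ := exists_outside (G := G) (K := {a, a'} ∪ {b, c}) (ne_univ_of_dg (hdeg a) (by
    rw [hdK, ind_neg (G.loopless.irrefl a), ind_neg hnaa]
    have := ind_le (G.Adj a b)
    have := ind_le (G.Adj a c)
    omega))
  have hdegC : ∀ w ∈ C, k ≤ dg G C w + (ind (G.Adj w a) + ind (G.Adj w a') +
      (ind (G.Adj w b) + ind (G.Adj w c))) := by
    intro w hw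
    rw [← hdK, ← hC.dg (Finset.subset_univ _) hw]
    exact hdeg w
  have path2 : ∀ {x y z} {K : Finset V}, x ∈ K → y ∈ K → z ∈ K → x ≠ z → G.Adj x y → G.Adj y z →
      PL G 2 K x z := by
    intro x y z K hx hy hz hxz hxy hyz
    refine ((PL.edge (A := {y, z}) (by simp) (by simp) hyz).cons (by simp [hxy.ne, hxz]) hxy).mono ?_
    simp [Finset.insert_subset_iff, *]
  have path3 : ∀ {x y z w} {K : Finset V}, x ∈ K → y ∈ K → z ∈ K → w ∈ K → x ≠ z → x ≠ w → y ≠ w →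
      G.Adj x y → G.Adj y z → G.Adj z w → PL G 3 K x w := by
    intro x y z w K hx hy hz hw hxz hxw hyw hxy hyz hzw
    refine ((path2 (K := {y, z, w}) (by simp) (by simp) (by simp) hyw hyz hzw).cons
      (by simp [hxy.ne, hxz, hxw]) hxy).mono ?_
    simp [Finset.insert_subset_iff, *]
  have three : ∀ {P : ℕ → Prop}, P 0 → P 1 → P 2 → ∀ i < 3, P i := by
    intro P h0 h1 h2 i hi
    interval_cases i <;> assumption
  have two : ∀ {P : ℕ → Prop}, P 0 → P 1 → ∀ i < 2, P i := by
    intro P h0 h1 i hi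
    interval_cases i <;> assumption
  have hcard : 1 < ({a, a'} ∪ {b, c} : Finset V).card :=
    Finset.one_lt_card.2 ⟨a, by simp, a', by simp, haa⟩
  have hmem : ∀ x ∈ ({a, a'} ∪ {b, c} : Finset V), x = a ∨ x = a' ∨ x = b ∨ x = c := by
    intro x hx
    simpa only [Finset.mem_union, Finset.mem_insert, Finset.mem_singleton, or_assoc] using hx
  by_cases tA : ∃ w ∈ C, ∃ x ∈ ({a, a'} : Finset V), G.Adj w x
  · by_cases tB : ∃ w ∈ C, ∃ x ∈ ({b, c} : Finset V), G.Adj w x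
    · refine consecutive_of_ears h hC Finset.subset_union_left hdis tA tB
        (D := k - 1) (m := 3) (d := 1) ?_ (fun w _ x hx hwx => ⟨x, hx, hwx⟩) (by omega) ?_ (by omega)
      · intro w hw
        have h1 := hdegC w hw
        rw [hmA, hmB]
        have h2 := h4 w b c a
        have h3 := h4 w b c a'
        unfold ind at *
        grind [SimpleGraph.Adj.symm]
      · intro x hx y hy
        simp only [Finset.mem_insert, Finset.mem_singleton] at hx hy
        rcases hx with rfl | rfl <;> rcases hy with rfl | rfl
        · exact three (PL.edge (by simp) (by simp) hab.symm)
            (path2 (y := c) (by simp) (by simp) (by simp) hab.ne' hbc hac.symm)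
            (path3 (y := a') (z := c) (by simp) (by simp) (by simp) (by simp) hbc.ne hab.ne' haa.symm
              hab'.symm hac' hac.symm)
        · exact three (PL.edge (by simp) (by simp) hac.symm)
            (path2 (y := b) (by simp) (by simp) (by simp) hac.ne' hbc.symm hab.symm)
            (path3 (y := a') (z := b) (by simp) (by simp) (by simp) (by simp) hbc.ne' hac.ne'
              haa.symm hac'.symm hab' hab.symm)
        · exact three (PL.edge (by simp) (by simp) hab'.symm)
            (path2 (y := c) (by simp) (by simp) (by simp) hab'.ne' hbc hac'.symm)
            (path3 (y := a) (z := c) (by simp) (by simp) (by simp) (by simp) hbc.ne hab'.ne' haa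
              hab.symm hac hac'.symm)
        · exact three (PL.edge (by simp) (by simp) hac'.symm)
            (path2 (y := b) (by simp) (by simp) (by simp) hac'.ne' hbc.symm hab'.symm)
            (path3 (y := a) (z := b) (by simp) (by simp) (by simp) (by simp) hbc.ne' hac'.ne'
              haa hac.symm hab hab'.symm)
    · push Not at tB
      have nb : ∀ w ∈ C, ¬ G.Adj w b := fun w hw => tB w hw b (by simp)
      have nc : ∀ w ∈ C, ¬ G.Adj w c := fun w hw => tB w hw c (by simp)
      obtain ⟨w, hw, x, hx, hxa, hwx⟩ := hC.touch_ne h (v := a) (by simp) hcard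
      obtain ⟨w', hw', y, hy, hya, hwy⟩ := hC.touch_ne h (v := a') (by simp) hcard
      obtain rfl : x = a' := by
        rcases hmem x hx with e | e | e | e
        exacts [absurd e hxa, e, absurd (e ▸ hwx) (nb w hw), absurd (e ▸ hwx) (nc w hw)]
      obtain rfl : y = a := by
        rcases hmem y hy with e | e | e | e
        exacts [e, absurd e hya, absurd (e ▸ hwy) (nb w' hw'), absurd (e ▸ hwy) (nc w' hw')]
      refine consecutive_of_ears h hC (A := {y}) (B := {x}) (D := k) (m := 2) (d := 2)
        (by simp) (by simpa using haa) ⟨w', hw', y, by simp, hwy⟩ ⟨w, hw, x, by simp, hwx⟩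
        ?_ ?_ le_rfl ?_ (by omega)
      · intro v hv
        have h1 := hdegC v hv
        rw [ind_neg (nb v hv), ind_neg (nc v hv)] at h1
        simp only [Finset.mem_singleton, exists_eq_left]
        omega
      · intro v hv z hz hvz
        refine ⟨z, ?_, hvz⟩
        rcases hmem z hz with e | e | e | e
        exacts [by simp [e], by simp [e], absurd (e ▸ hvz) (nb v hv), absurd (e ▸ hvz) (nc v hv)]
      · simp only [Finset.mem_singleton]
        rintro _ rfl _ rfl
        exact two (path2 (y := b) (by simp) (by simp) (by simp) hxa hab' hab.symm)
          (path3 (y := b) (z := c) (by simp) (by simp) (by simp) (by simp) hac'.ne hxa hab.ne' hab'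
            hbc hac.symm)
  · push Not at tA
    have na : ∀ w ∈ C, ¬ G.Adj w a := fun w hw => tA w hw a (by simp)
    have na' : ∀ w ∈ C, ¬ G.Adj w a' := fun w hw => tA w hw a' (by simp)
    obtain ⟨w, hw, x, hx, hxb, hwx⟩ := hC.touch_ne h (v := b) (by simp) hcard
    obtain ⟨w', hw', y, hy, hyc, hwy⟩ := hC.touch_ne h (v := c) (by simp) hcard
    obtain rfl : x = c := by
      rcases hmem x hx with e | e | e | e
      exacts [absurd (e ▸ hwx) (na w hw), absurd (e ▸ hwx) (na' w hw), absurd e hxb, e]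
    obtain rfl : y = b := by
      rcases hmem y hy with e | e | e | e
      exacts [absurd (e ▸ hwy) (na w' hw'), absurd (e ▸ hwy) (na' w' hw'), e, absurd e hyc]
    refine consecutive_of_ears h hC (A := {y}) (B := {x}) (D := k) (m := 2) (d := 1)
      (by simp) (by simpa using hbc.ne) ⟨w', hw', y, by simp, hwy⟩
      ⟨w, hw, x, by simp, hwx⟩ ?_ ?_ le_rfl ?_ (by omega)
    · intro v hv
      have h1 := hdegC v hv
      rw [ind_neg (na v hv), ind_neg (na' v hv)] at h1
      simp only [Finset.mem_singleton, exists_eq_left]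
      omega
    · intro v hv z hz hvz
      refine ⟨z, ?_, hvz⟩
      rcases hmem z hz with e | e | e | e
      exacts [absurd (e ▸ hvz) (na v hv), absurd (e ▸ hvz) (na' v hv), by simp [e], by simp [e]]
    · simp only [Finset.mem_singleton]
      rintro _ rfl _ rfl
      exact two (PL.edge (by simp) (by simp) hbc.symm)
        (path2 (y := a) (by simp) (by simp) (by simp) hxb hac.symm hab)

end EarCycles

/-- For `k ≥ 2`, every 2-connected graph of minimum degree at least `k` containing a triangle
contains `k` cycles of consecutive lengths, unless it is isomorphic to `K_{k+1}`. -/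
theorem stmt_9 {V : Type*} [Fintype V] (k : ℕ) (hk : 2 ≤ k)
    (G : SimpleGraph V) [DecidableRel G.Adj]
    (h2 : TwoConnected G) (hdeg : ∀ v : V, k ≤ G.degree v) (htriangle : ¬ G.CliqueFree 3) :
    Nonempty (G ≃g SimpleGraph.completeGraph (Fin (k + 1))) ∨
      ∃ ℓ : ℕ, ∀ i < k, HasCycleLength G (ℓ + i) := by
  classical
  have hd : ∀ v, k ≤ EarCycles.dg G Finset.univ v := fun v => by
    convert hdeg v
    rw [← SimpleGraph.card_neighborFinset_eq_degree, EarCycles.dg]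
    congr 1
    ext x
    simp
  obtain ⟨T, hT⟩ : ∃ T : Finset V, G.IsNClique 3 T := by
    by_contra hcon
    push Not at hcon
    exact htriangle hcon
  obtain ⟨K, hK, hmax⟩ := Finset.exists_max_image
    (Finset.univ.filter fun K : Finset V => G.IsClique (K : Set V)) Finset.card
    ⟨T, by simpa using hT.1⟩
  simp only [Finset.mem_filter, Finset.mem_univ, true_and] at hK hmax
  have hK3 : 3 ≤ K.card := hT.2 ▸ hmax T hT.1
  have hmaxK : ∀ w, w ∉ K → ∃ x ∈ K, ¬ G.Adj w x := by
    intro w hw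
    by_contra hcon
    push Not at hcon
    have := hmax (insert w K) (by
      rw [Finset.coe_insert, SimpleGraph.isClique_insert]
      exact ⟨hK, fun x hx _ => hcon x hx⟩)
    rw [Finset.card_insert_of_notMem hw] at this
    omega
  by_cases c1 : k + 1 ≤ K.card
  · by_cases hu : K = Finset.univ
    · by_cases c2 : k + 2 ≤ K.card
      · exact Or.inr ⟨3, fun i hi => EarCycles.clique_cycle hK (by omega) (by omega)⟩
      · left
        subst hu
        obtain rfl : G = ⊤ := by
          ext x y
          exact ⟨fun hh => hh.ne, fun hh => hK (by simp) (by simp) hh⟩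
        exact ⟨SimpleGraph.Iso.completeGraph (Fintype.equivFinOfCardEq
          (by rw [← Finset.card_univ]; omega))⟩
    · exact Or.inr (EarCycles.consecutive_of_large_clique h2 hk hK c1 hu)
  by_cases c4 : 4 ≤ K.card
  · exact Or.inr (EarCycles.consecutive_of_maximal_clique h2 hd hK c4 (by omega) hmaxK)
  right
  by_cases hw : ∀ w, w ∉ K → EarCycles.dg G K w ≤ 1
  · exact EarCycles.consecutive_of_triangle h2 (by omega) hd hK (by omega) hw
  push Not at hw
  obtain ⟨w, hwK, hdw⟩ := hw
  obtain ⟨b, hb, c, hc, hbc, hwb, hwc⟩ := EarCycles.one_lt_dg hdw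
  obtain ⟨a, ha, hwa⟩ := hmaxK w hwK
  have hab : a ≠ b := fun e => hwa (e ▸ hwb)
  have hac : a ≠ c := fun e => hwa (e ▸ hwc)
  exact EarCycles.consecutive_of_diamond h2 (by omega) hd (fun K' hK' => (hmax K' hK').trans (by omega))
    (a := a) (a' := w) (fun e => hwK (e ▸ ha)) (hK hb hc hbc) (hK ha hb hab) (hK ha hc hac) hwb hwc
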